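/- Let d ≥ 3 be an integer and let p > d/(d-2). Then the bilinear discrete spherical maximal operator T* is bounded from l^{2p}(ℤ^d) × l^{2p}(ℤ^d) to l^p(ℤ^d): there exists a constant C = C(d,p) such that for all f, g ∈ l^{2p}(ℤ^d), ‖T*(f,g)‖_{l^p(ℤ^d)} ≤ C ‖f‖_{l^{2p}(ℤ^d)} ‖g‖_{l^{2p}(ℤ^d)}. -/

import Mathlib

open scoped ENNReal NNReal BigOperators

noncomputable section

/-- `ℤ^d` -/
abbrev V (d : ℕ) := Fin d → ℤ

/-- The sphere `{(u,v) ∈ ℤ^d × ℤ^d : |u|² + |v|² = λ}`. -/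
def sph (d lam : ℕ) : Set (V d × V d) :=
  {uv | (∑ i, uv.1 i ^ 2) + (∑ i, uv.2 i ^ 2) = (lam : ℤ)}

/-- `N(λ)`, the number of lattice points on the sphere of radius `λ^{1/2}` in `ℝ^{2d}`. -/
def Ncount (d lam : ℕ) : ℕ := Nat.card (sph d lam)

/-- The bilinear discrete spherical average `T_λ(f,g)(x)`. -/
def avg (d lam : ℕ) (f g : V d → ℂ) (x : V d) : ℂ :=
  (Ncount d lam : ℂ)⁻¹ *
    ∑' uv : sph d lam, f (x - (uv : V d × V d).1) * g (x - (uv : V d × V d).2)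

/-- The bilinear discrete spherical maximal function
`T*(f,g)(x) = sup_{λ ∈ ℕ, N(λ) > 0} |T_λ(f,g)(x)|`. -/
def maxOp (d : ℕ) (f g : V d → ℂ) (x : V d) : ℝ≥0∞ :=
  ⨆ (lam : ℕ) (_ : 0 < Ncount d lam), (‖avg d lam f g x‖₊ : ℝ≥0∞)

/-- The `l^p(ℤ^d)` norm of a complex-valued function. -/
def lpNorm (d : ℕ) (p : ℝ) (f : V d → ℂ) : ℝ≥0∞ :=
  (∑' x : V d, (‖f x‖₊ : ℝ≥0∞) ^ p) ^ (1 / p)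

/-- The `l^p(ℤ^d)` norm of an `ℝ≥0∞`-valued function. -/
def lpNormE (d : ℕ) (p : ℝ) (F : V d → ℝ≥0∞) : ℝ≥0∞ :=
  (∑' x : V d, F x ^ p) ^ (1 / p)

/-- The `l^∞(ℤ^d)` norm. -/
def linftyNorm (d : ℕ) (f : V d → ℂ) : ℝ≥0∞ :=
  ⨆ x : V d, (‖f x‖₊ : ℝ≥0∞)

open ZMod in
/-- The divisor sum of the nontrivial character modulo `4`. -/
def chiDivisorSum (n : ℕ) : ℤ := ∑ a ∈ n.divisors, χ₄ (a : ZMod 4)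

open ZMod in
theorem chiDivisorSum_mul {m n : ℕ} (h : m.Coprime n) :
    chiDivisorSum (m * n) = chiDivisorSum m * chiDivisorSum n := by
  let f : ArithmeticFunction ℤ :=
    ⟨fun n => χ₄ (n : ZMod 4), by decide⟩
  have hfa : ∀ n, f n = χ₄ (n : ZMod 4) := fun _ => rfl
  have hf : f.IsMultiplicative := by
    refine ⟨by rw [hfa, Nat.cast_one, map_one], fun {m n} _ => ?_⟩
    rw [hfa, hfa, hfa, Nat.cast_mul, map_mul]
  have hm := (hf.mul ArithmeticFunction.isMultiplicative_zeta.natCast).map_mul_of_coprime h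
  simp only [ArithmeticFunction.coe_mul_zeta_apply] at hm
  exact hm

open ZMod in
theorem chiDivisorSum_prime_pow {p : ℕ} (hp : p.Prime) (k : ℕ) :
    chiDivisorSum (p ^ k) = ∑ i ∈ Finset.range (k + 1), (χ₄ (p : ZMod 4)) ^ i := by
  rw [chiDivisorSum, Nat.sum_divisors_prime_pow hp]
  refine Finset.sum_congr rfl fun i _ => ?_
  rw [Nat.cast_pow, map_pow]

/-- Gaussian integers of norm `n`. -/
def gaussNorm (n : ℕ) : Set GaussianInt := {z | z.norm = n}

theorem gaussNorm_finite (n : ℕ) : (gaussNorm n).Finite := by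
  refine ((Set.finite_Icc (-(n : ℤ)) n).prod (Set.finite_Icc (-(n : ℤ)) n)).preimage
    (f := fun z : GaussianInt => (z.re, z.im)) ?_ |>.subset ?_
  · intro a _ b _ h
    simpa [Zsqrtd.ext_iff] using h
  · intro z hz
    simp only [gaussNorm, Set.mem_ofPred_eq, Zsqrtd.norm_def] at hz
    simp only [Set.mem_preimage, Set.mem_prod, Set.mem_Icc]
    refine ⟨⟨?_, ?_⟩, ?_, ?_⟩ <;> nlinarith [sq_nonneg (z.re), sq_nonneg z.im]

theorem gaussNorm_ncard_mul_le {m n : ℕ} {w : GaussianInt} (hw : w.norm = m) (hw0 : w ≠ 0) :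
    (gaussNorm n).ncard ≤ (gaussNorm (m * n)).ncard := by
  refine Set.ncard_le_ncard_of_injOn (fun z => w * z) ?_ ?_ (gaussNorm_finite _)
  · intro z hz
    simp only [gaussNorm, Set.mem_ofPred_eq] at *
    rw [Zsqrtd.norm_mul, hw, hz]; push_cast; rfl
  · intro a _ b _ h
    exact mul_left_cancel₀ hw0 h

theorem gaussNorm_ncard_split {p : ℕ} (hp : p.Prime) (hp1 : p % 4 = 1) (k : ℕ) {n : ℕ}
    (hn : ¬ p ∣ n) : (k + 1) * (gaussNorm n).ncard ≤ (gaussNorm (p ^ k * n)).ncard := by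
  have := Fact.mk hp
  obtain ⟨a, b, hab⟩ := Nat.Prime.sq_add_sq (p := p) (by omega)
  have hp0 := hp.pos
  let w : GaussianInt := ⟨a, b⟩
  let w' : GaussianInt := ⟨a, -b⟩
  have hwn : w.norm = p := by simp [w, Zsqrtd.norm_def, ← hab]; ring
  have hwn' : w'.norm = p := by simp [w', Zsqrtd.norm_def, ← hab]; ring
  have hw0 : w ≠ 0 := by
    intro h; rw [h] at hwn; simp at hwn; omega
  have hw0' : w' ≠ 0 := by
    intro h; rw [h] at hwn'; simp at hwn'; omega
  have hirr : Irreducible w := by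
    refine ⟨?_, ?_⟩
    · rw [← Zsqrtd.norm_eq_one_iff, hwn]; simp; exact hp.one_lt.ne'
    · intro x y hxy
      have h1 : x.norm.natAbs * y.norm.natAbs = p := by
        rw [← Int.natAbs_mul, ← Zsqrtd.norm_mul, ← hxy, hwn]; simp
      rw [← Zsqrtd.norm_eq_one_iff, ← Zsqrtd.norm_eq_one_iff]
      exact (Nat.dvd_prime hp).1 (Dvd.intro _ h1) |>.imp id
        (fun h => by rw [h] at h1; exact (Nat.mul_eq_left hp0.ne').1 h1)
  have hprime : Prime w := hirr.prime
  have hndvd : ¬ w ∣ w' := by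
    intro h
    have h2 : w ∣ (2 * a : GaussianInt) := by
      have : (2 * a : GaussianInt) = w + w' := by
        ext <;> simp [w, w']; ring
      rw [this]; exact dvd_add dvd_rfl h
    have h3 : (p : ℤ) ∣ (2 * a) ^ 2 := by
      obtain ⟨c, hc⟩ := h2
      have := congrArg Zsqrtd.norm hc
      rw [Zsqrtd.norm_mul w, hwn] at this
      have h4 : (2 * a : GaussianInt).norm = (2 * a) ^ 2 := by
        simp [Zsqrtd.norm_def]; ring
      exact ⟨c.norm, by rw [← this, h4]⟩
    have h4 : p ∣ 2 * a := by
      have : p ∣ (2 * a) ^ 2 := by exact_mod_cast h3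
      exact hp.dvd_of_dvd_pow this
    have h5 : p ∣ a := by
      rcases hp.dvd_mul.1 h4 with h | h
      · have := Nat.le_of_dvd (by norm_num) h
        interval_cases p <;> omega
      · exact h
    have ha : a ≠ 0 := by
      rintro rfl
      have : p = b ^ 2 := by simpa using hab.symm
      rw [this] at hp
      exact Nat.Prime.not_prime_pow (le_refl 2) hp
    have h6 := Nat.le_of_dvd (Nat.pos_of_ne_zero ha) h5
    have : a * a < p * p := by
      have : b ≠ 0 := by
        rintro rfl
        have : p = a ^ 2 := by simpa using hab.symm
        rw [this] at hp
        exact Nat.Prime.not_prime_pow (le_refl 2) hp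
      have : 0 < b ^ 2 := by positivity
      nlinarith
    nlinarith
  have key : ∀ i j : ℕ, i ≤ k → j ≤ k → i < j → ∀ x ∈ gaussNorm n, ∀ y,
      w ^ i * w' ^ (k - i) * x ≠ w ^ j * w' ^ (k - j) * y := by
    intro i j hi hj hij x hx y h
    have e1 : w ^ i * w' ^ (k - i) * x = (w ^ i * w' ^ (k - j)) * (w' ^ (j - i) * x) := by
      rw [show k - i = (k - j) + (j - i) by omega, pow_add]; ring
    have e2 : w ^ j * w' ^ (k - j) * y = (w ^ i * w' ^ (k - j)) * (w ^ (j - i) * y) := by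
      nth_rw 1 [show j = i + (j - i) by omega]
      rw [pow_add]; ring
    rw [e1, e2] at h
    have h1 := mul_left_cancel₀ (mul_ne_zero (pow_ne_zero _ hw0) (pow_ne_zero _ hw0')) h
    have h2 : w ∣ w' ^ (j - i) * x := by
      rw [h1]; exact Dvd.dvd.mul_right (dvd_pow_self _ (by omega)) _
    rcases hprime.dvd_or_dvd h2 with h3 | ⟨c, hc⟩
    · exact hndvd (hprime.dvd_of_dvd_pow h3)
    · apply hn
      have := congrArg Zsqrtd.norm hc
      rw [Zsqrtd.norm_mul, hwn, hx] at this
      exact_mod_cast Dvd.intro _ this.symm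
  have hcard : ((Set.Iio (k + 1)) ×ˢ gaussNorm n).ncard = (k + 1) * (gaussNorm n).ncard := by
    rw [Set.ncard_prod]; congr 1
    rw [← Finset.coe_Iio, Set.ncard_coe_finset]; simp
  rw [← hcard]
  refine Set.ncard_le_ncard_of_injOn (fun q => w ^ q.1 * w' ^ (k - q.1) * q.2) ?_ ?_
    (gaussNorm_finite _)
  · rintro ⟨i, z⟩ ⟨hi, hz⟩
    simp only [Set.mem_Iio] at hi
    simp only [gaussNorm, Set.mem_ofPred_eq] at *
    have hpow : ∀ (u : GaussianInt) (m : ℕ), (u ^ m).norm = u.norm ^ m := fun u m =>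
      map_pow (Zsqrtd.normMonoidHom) u m
    rw [Zsqrtd.norm_mul, Zsqrtd.norm_mul, hpow, hpow, hwn, hwn', hz, ← pow_add,
      show i + (k - i) = k by omega]
    push_cast; rfl
  · rintro ⟨i, x⟩ ⟨hi, hx⟩ ⟨j, y⟩ ⟨hj, hy⟩ h
    simp only [Set.mem_Iio] at hi hj h
    rcases lt_trichotomy i j with hij | hij | hij
    · exact absurd h (key i j (by omega) (by omega) hij x hx y)
    · subst hij
      have := mul_left_cancel₀ (mul_ne_zero (pow_ne_zero _ hw0) (pow_ne_zero _ hw0')) h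
      rw [this]
    · exact absurd h.symm (key j i (by omega) (by omega) hij y hy x)

open ZMod in
theorem chiDivisorSum_le_ncard (n : ℕ) : chiDivisorSum n ≤ (gaussNorm n).ncard := by
  induction n using Nat.recOnPrimePow with
  | zero => simp [chiDivisorSum]
  | one =>
    have : 0 < (gaussNorm 1).ncard := by
      rw [Set.ncard_pos (gaussNorm_finite 1)]
      exact ⟨1, by simp [gaussNorm]⟩
    simp only [chiDivisorSum, Nat.divisors_one, Finset.sum_singleton, Nat.cast_one, map_one]
    exact_mod_cast this
  | prime_pow_mul a p n hp hpa hn ih =>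
    have hcop : (p ^ n).Coprime a := Nat.Coprime.pow_left _ ((Nat.Prime.coprime_iff_not_dvd hp).2 hpa)
    rw [chiDivisorSum_mul hcop, chiDivisorSum_prime_pow hp]
    have hp4 : p = 2 ∨ p % 4 = 1 ∨ p % 4 = 3 := by
      rcases hp.eq_two_or_odd with h | h
      · exact Or.inl h
      · right; omega
    rcases hp4 with rfl | h1 | h3
    · have : χ₄ ((2 : ℕ) : ZMod 4) = 0 := by decide
      rw [this, Finset.sum_range_succ']
      simp only [ne_eq, Nat.add_eq_zero_iff, one_ne_zero, and_false, not_false_eq_true, zero_pow,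
        Finset.sum_const_zero, pow_zero, zero_add, one_mul]
      refine ih.trans ?_
      have hpow : ∀ (u : GaussianInt) (m : ℕ), (u ^ m).norm = u.norm ^ m := fun u m =>
        map_pow (Zsqrtd.normMonoidHom) u m
      have := gaussNorm_ncard_mul_le (m := 2 ^ n) (n := a) (w := (⟨1, 1⟩ : GaussianInt) ^ n)
        (by rw [hpow]; simp [Zsqrtd.norm_def])
        (pow_ne_zero _ (by simp [Zsqrtd.ext_iff]))
      exact_mod_cast this
    · rw [χ₄_nat_one_mod_four h1]
      simp only [one_pow, Finset.sum_const, Finset.card_range, nsmul_eq_mul, mul_one]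
      have := gaussNorm_ncard_split hp h1 n hpa
      calc ((n + 1 : ℕ) : ℤ) * chiDivisorSum a ≤ ((n + 1 : ℕ) : ℤ) * (gaussNorm a).ncard := by gcongr
        _ ≤ _ := by exact_mod_cast this
    · rw [χ₄_nat_three_mod_four h3]
      rcases Nat.even_or_odd n with he | ho
      · have hs : ∑ i ∈ Finset.range (n + 1), (-1 : ℤ) ^ i = 1 := by
          rw [neg_one_geom_sum, if_neg (by simpa [Nat.even_add_one] using he)]
        rw [hs, one_mul]
        refine ih.trans ?_
        obtain ⟨k, rfl⟩ := he
        have := gaussNorm_ncard_mul_le (m := p ^ (k + k)) (n := a)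
          (w := ((p ^ k : ℕ) : GaussianInt))
          (by rw [Zsqrtd.norm_natCast]; push_cast; ring)
          (by exact_mod_cast pow_ne_zero _ hp.ne_zero)
        exact_mod_cast this
      · have hs : ∑ i ∈ Finset.range (n + 1), (-1 : ℤ) ^ i = 0 := by
          rw [neg_one_geom_sum, if_pos (by simpa [Nat.even_add_one] using ho)]
        rw [hs, zero_mul]
        positivity

open ZMod in
theorem chiDivisorSum_nonneg (n : ℕ) : 0 ≤ chiDivisorSum n := by
  induction n using Nat.recOnPrimeCoprime with
  | zero => simp [chiDivisorSum]
  | prime_pow p n hp =>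
    rw [chiDivisorSum_prime_pow hp, χ₄_nat_eq_if_mod_four]
    split_ifs
    · exact Finset.sum_nonneg fun i _ => by positivity
    · simp; positivity
    · rw [neg_one_geom_sum]; split_ifs <;> norm_num
  | coprime a b _ _ hab ha hb =>
    rw [chiDivisorSum_mul hab]; positivity

open ZMod in
theorem chi_four_mul_of_odd {a b : ℕ} (ha : Odd a) (hb : Odd b) :
    χ₄ (a : ZMod 4) * χ₄ (b : ZMod 4) = if a % 4 = b % 4 then 1 else -1 := by
  rw [χ₄_nat_eq_if_mod_four, χ₄_nat_eq_if_mod_four]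
  rw [Nat.odd_iff] at ha hb
  rw [if_neg (show ¬ a % 2 = 0 by omega), if_neg (show ¬ b % 2 = 0 by omega)]
  have : a % 4 = 1 ∨ a % 4 = 3 := by omega
  have : b % 4 = 1 ∨ b % 4 = 3 := by omega
  rcases ‹a % 4 = 1 ∨ a % 4 = 3› with h | h <;> rcases this with h' | h' <;> simp [h, h']

/-- Quadruples `((a, x), (b, y))` of odd numbers with `a * x + b * y = 2 * n`. -/
def oddQuadruples (n : ℕ) : Finset ((ℕ × ℕ) × (ℕ × ℕ)) :=
  ((Finset.range (2 * n + 1) ×ˢ Finset.range (2 * n + 1)) ×ˢ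
    (Finset.range (2 * n + 1) ×ˢ Finset.range (2 * n + 1))).filter
    fun e => Odd (e.1.1 * e.1.2) ∧ e.1.1 * e.1.2 + e.2.1 * e.2.2 = 2 * n

theorem mem_oddQuadruples {n a x b y : ℕ} :
    ((a, x), (b, y)) ∈ oddQuadruples n ↔
      (Odd a ∧ Odd x ∧ Odd b ∧ Odd y) ∧ a * x + b * y = 2 * n := by
  simp only [oddQuadruples, Finset.mem_filter, Finset.mem_product, Finset.mem_range]
  constructor
  · rintro ⟨-, h1, h2⟩
    have h3 : Odd (b * y) := by
      rw [Nat.odd_iff] at *; omega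
    exact ⟨⟨(Nat.odd_mul.1 h1).1, (Nat.odd_mul.1 h1).2, (Nat.odd_mul.1 h3).1,
      (Nat.odd_mul.1 h3).2⟩, h2⟩
  · rintro ⟨⟨ha, hx, hb, hy⟩, h⟩
    have := ha.pos; have := hx.pos; have := hb.pos; have := hy.pos
    have h1 := Nat.le_mul_of_pos_right a hx.pos
    have h2 := Nat.le_mul_of_pos_left x ha.pos
    have h3 := Nat.le_mul_of_pos_right b hy.pos
    have h4 := Nat.le_mul_of_pos_left y hb.pos
    exact ⟨⟨⟨by omega, by omega⟩, by omega, by omega⟩, ha.mul hx, h⟩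

open ZMod in
/-- Dirichlet's involution: the off-diagonal terms cancel. -/
theorem sum_oddQuadruples_gt {n : ℕ} (hn : Odd n) :
    ∑ e ∈ (oddQuadruples n).filter (fun e => e.2.1 < e.1.1),
      χ₄ (e.1.1 : ZMod 4) * χ₄ (e.2.1 : ZMod 4) = 0 := by
  let φ : (ℕ × ℕ) × (ℕ × ℕ) → (ℕ × ℕ) × (ℕ × ℕ) := fun e =>
    let k := e.1.1 - e.2.1
    let s := e.1.2 + e.2.2
    ((e.1.2 + s * (e.2.1 / k + 1), e.2.1 % k), (e.1.2 + s * (e.2.1 / k), k - e.2.1 % k))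
  have hmod : ∀ a x b y, ((a, x), (b, y)) ∈ (oddQuadruples n).filter (fun e => e.2.1 < e.1.1) →
      ∃ k' s', a = b + 2 * k' ∧ x + y = 2 * s' ∧ 0 < k' ∧ 0 < s' ∧ Odd (k' + s') := by
    intro a x b y h
    rw [Finset.mem_filter, mem_oddQuadruples] at h
    obtain ⟨⟨⟨ha, hx, hb, hy⟩, h⟩, hlt⟩ := h
    simp only at hlt
    have ha' := ha; have hx' := hx; have hb' := hb; have hy' := hy
    obtain ⟨a1, rfl⟩ := ha; obtain ⟨x1, rfl⟩ := hx; obtain ⟨b1, rfl⟩ := hb; obtain ⟨y1, rfl⟩ := hy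
    obtain ⟨k', rfl⟩ : ∃ k', a1 = b1 + k' := ⟨a1 - b1, by omega⟩
    refine ⟨k', x1 + y1 + 1, by ring, by ring, by omega, by omega, ?_⟩
    have h2 : k' * (2 * x1 + 1) + (2 * b1 + 1) * (x1 + y1 + 1) = n := by linarith
    rw [← h2] at hn
    simpa [Nat.odd_add, Nat.odd_mul, Nat.even_mul, ← Nat.not_odd_iff_even, parity_simps] using hn
  refine Finset.sum_involution (fun e _ => φ e) ?_ ?_ ?_ ?_
  · rintro ⟨⟨a, x⟩, b, y⟩ h
    obtain ⟨k', s', rfl, hs, hk0, hs0, hodd⟩ := hmod a x b y h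
    rw [Finset.mem_filter, mem_oddQuadruples] at h
    obtain ⟨⟨⟨ha, hx, hb, hy⟩, h⟩, hlt⟩ := h
    simp only [φ]
    rw [chi_four_mul_of_odd ha hb, chi_four_mul_of_odd, hs, mul_add]
    · generalize 2 * s' * (b / (b + 2 * k' - b)) = z
      rw [Nat.odd_iff] at hodd hb hx
      split_ifs <;> omega
    · rw [hs]
      exact hx.add_even (by simp [mul_assoc])
    · rw [hs]
      exact hx.add_even (by simp [mul_assoc])
  · rintro ⟨⟨a, x⟩, b, y⟩ h hne heq
    obtain ⟨k', s', rfl, hs, hk0, hs0, hodd⟩ := hmod a x b y h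
    simp only [φ, Prod.mk.injEq] at heq
    rw [show b + 2 * k' - b = 2 * k' by omega] at heq
    obtain ⟨⟨h1, h2⟩, h3, h4⟩ := heq
    rw [mul_add] at h1
    rw [Nat.odd_iff] at hodd
    omega
  · rintro ⟨⟨a, x⟩, b, y⟩ h
    obtain ⟨k', s', rfl, hs, hk0, hs0, hodd⟩ := hmod a x b y h
    rw [Finset.mem_filter, mem_oddQuadruples] at h
    obtain ⟨⟨⟨ha, hx, hb, hy⟩, h⟩, hlt⟩ := h
    simp only [φ]
    rw [Finset.mem_filter, mem_oddQuadruples]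
    rw [show b + 2 * k' - b = 2 * k' by omega, hs]
    have hml : b % (2 * k') < 2 * k' := Nat.mod_lt _ (by omega)
    have hmo : Odd (b % (2 * k')) := by
      rw [Nat.odd_iff, Nat.mod_mul_right_mod]; exact Nat.odd_iff.1 hb
    refine ⟨⟨⟨hx.add_even (by simp [mul_assoc]), hmo, hx.add_even (by simp [mul_assoc]),
      Nat.Even.sub_odd hml.le (by simp) hmo⟩, ?_⟩, ?_⟩
    · obtain ⟨y', hy'⟩ : ∃ y', y' = 2 * k' - b % (2 * k') := ⟨_, rfl⟩
      have hy2 : b % (2 * k') + y' = 2 * k' := by omega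
      rw [← hy', ← h]
      have hb2 := Nat.mod_add_div b (2 * k')
      generalize b % (2 * k') = r at *
      generalize b / (2 * k') = t at *
      have hyz : b * y + b * x = b * (2 * s') := by rw [← hs]; ring
      calc (x + 2 * s' * (t + 1)) * r + (x + 2 * s' * t) * y'
          = (x + 2 * s' * t) * (r + y') + 2 * s' * r := by ring
        _ = x * (2 * k') + 2 * s' * (r + 2 * k' * t) := by rw [hy2]; ring
        _ = x * (2 * k') + (b * y + b * x) := by rw [hb2, hyz]; ring
        _ = _ := by ring
    · simp only [mul_add]; omega
  · rintro ⟨⟨a, x⟩, b, y⟩ h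
    obtain ⟨k', s', rfl, hs, hk0, hs0, hodd⟩ := hmod a x b y h
    rw [Finset.mem_filter, mem_oddQuadruples] at h
    obtain ⟨⟨⟨ha, hx, hb, hy⟩, h⟩, hlt⟩ := h
    simp only [φ]
    rw [show b + 2 * k' - b = 2 * k' by omega, hs]
    have hml : b % (2 * k') < 2 * k' := Nat.mod_lt _ (by omega)
    have e1 : x + 2 * s' * (b / (2 * k') + 1) - (x + 2 * s' * (b / (2 * k'))) = 2 * s' := by
      rw [mul_add]; omega
    have hxs : x < 2 * s' := by have := hy.pos; omega
    have e2 : (x + 2 * s' * (b / (2 * k'))) / (2 * s') = b / (2 * k') := by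
      rw [Nat.add_mul_div_left _ _ (by omega), Nat.div_eq_of_lt hxs, zero_add]
    have e3 : (x + 2 * s' * (b / (2 * k'))) % (2 * s') = x := by
      rw [Nat.add_mul_mod_self_left, Nat.mod_eq_of_lt hxs]
    have e4 : b % (2 * k') + (2 * k' - b % (2 * k')) = 2 * k' := by omega
    have hb2 := Nat.mod_add_div b (2 * k')
    rw [e1, e2, e3, e4, mul_add]
    simp only [Prod.mk.injEq]
    exact ⟨⟨by linarith, trivial⟩, hb2, Nat.sub_eq_of_eq_add (by linarith)⟩

open ZMod in
theorem le_sum_chiDivisorSum {n : ℕ} (hn : Odd n) :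
    (n : ℤ) ≤ ∑ uv ∈ (Finset.HasAntidiagonal.antidiagonal (2 * n)).filter (fun uv => Odd uv.1),
      chiDivisorSum uv.1 * chiDivisorSum uv.2 := by
  have hsum : ∑ uv ∈ (Finset.HasAntidiagonal.antidiagonal (2 * n)).filter (fun uv => Odd uv.1),
      chiDivisorSum uv.1 * chiDivisorSum uv.2 =
      ∑ e ∈ oddQuadruples n, χ₄ (e.1.1 : ZMod 4) * χ₄ (e.2.1 : ZMod 4) := by
    rw [← Finset.sum_fiberwise_of_maps_to
      (t := (Finset.HasAntidiagonal.antidiagonal (2 * n)).filter (fun uv => Odd uv.1))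
      (g := fun e : (ℕ × ℕ) × (ℕ × ℕ) => (e.1.1 * e.1.2, e.2.1 * e.2.2))]
    · refine Finset.sum_congr rfl fun uv huv => ?_
      obtain ⟨u, v⟩ := uv
      rw [Finset.mem_filter, Finset.HasAntidiagonal.mem_antidiagonal] at huv
      obtain ⟨huv, hu⟩ := huv
      simp only at huv hu
      have hv : Odd v := by rw [Nat.odd_iff] at *; omega
      have : (oddQuadruples n).filter (fun e => (e.1.1 * e.1.2, e.2.1 * e.2.2) = (u, v)) =
          u.divisorsAntidiagonal ×ˢ v.divisorsAntidiagonal := by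
        ext ⟨⟨a, x⟩, b, y⟩
        rw [Finset.mem_filter, mem_oddQuadruples]
        simp only [Prod.mk.injEq, Finset.mem_product, Nat.mem_divisorsAntidiagonal]
        constructor
        · rintro ⟨-, h1, h2⟩
          exact ⟨⟨h1, hu.pos.ne'⟩, h2, hv.pos.ne'⟩
        · rintro ⟨⟨rfl, -⟩, rfl, -⟩
          rw [Nat.odd_mul] at hu hv
          exact ⟨⟨⟨hu.1, hu.2, hv.1, hv.2⟩, huv⟩, rfl, rfl⟩
      rw [this, Finset.sum_product]
      simp only [chiDivisorSum]
      rw [← Nat.sum_divisorsAntidiagonal (fun a _ => χ₄ (a : ZMod 4)),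
        ← Nat.sum_divisorsAntidiagonal (fun a _ => χ₄ (a : ZMod 4)), Finset.sum_mul_sum]
    · rintro ⟨⟨a, x⟩, b, y⟩ h
      rw [mem_oddQuadruples] at h
      simp [h.2, h.1.1.mul h.1.2.1]
  rw [hsum]
  have h1 := sum_oddQuadruples_gt hn
  have h2 : ∑ e ∈ (oddQuadruples n).filter (fun e => e.1.1 < e.2.1),
      χ₄ (e.1.1 : ZMod 4) * χ₄ (e.2.1 : ZMod 4) = 0 := by
    rw [← h1]
    refine Finset.sum_nbij' Prod.swap Prod.swap ?_ ?_ ?_ ?_ ?_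
    · rintro ⟨⟨a, x⟩, b, y⟩ h
      simp only [Finset.mem_filter, mem_oddQuadruples, Prod.swap] at h ⊢
      exact ⟨⟨⟨h.1.1.2.2.1, h.1.1.2.2.2, h.1.1.1, h.1.1.2.1⟩, by linarith [h.1.2]⟩, h.2⟩
    · rintro ⟨⟨a, x⟩, b, y⟩ h
      simp only [Finset.mem_filter, mem_oddQuadruples, Prod.swap] at h ⊢
      exact ⟨⟨⟨h.1.1.2.2.1, h.1.1.2.2.2, h.1.1.1, h.1.1.2.1⟩, by linarith [h.1.2]⟩, h.2⟩
    · intro _ _; rfl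
    · intro _ _; rfl
    · intro _ _; exact mul_comm _ _
  have h3 : (n : ℤ) ≤ ∑ e ∈ (oddQuadruples n).filter (fun e => e.1.1 = e.2.1),
      χ₄ (e.1.1 : ZMod 4) * χ₄ (e.2.1 : ZMod 4) := by
    rw [Finset.sum_congr rfl (g := fun _ => (1 : ℤ))]
    · rw [Finset.sum_const, nsmul_eq_mul, mul_one]
      have := Finset.card_le_card_of_injOn (s := Finset.range n)
        (t := (oddQuadruples n).filter (fun e => e.1.1 = e.2.1))
        (fun i => ((1, 2 * i + 1), (1, 2 * (n - 1 - i) + 1))) ?_ ?_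
      · rw [Finset.card_range] at this; exact_mod_cast this
      · intro i hi
        simp only [Finset.coe_range, Set.mem_Iio] at hi
        simp only [Finset.coe_filter, Set.mem_ofPred_eq, mem_oddQuadruples]
        refine ⟨⟨⟨odd_one, ⟨i, rfl⟩, odd_one, ⟨_, rfl⟩⟩, by omega⟩, trivial⟩
      · intro i _ j _ h
        simp only [Prod.mk.injEq] at h
        omega
    · rintro ⟨⟨a, x⟩, b, y⟩ h
      simp only [Finset.mem_filter, mem_oddQuadruples] at h
      rw [chi_four_mul_of_odd h.1.1.1 h.1.1.2.2.1, if_pos (by rw [h.2])]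
  rw [← Finset.sum_filter_add_sum_filter_not _ (fun e => e.1.1 = e.2.1),
    ← Finset.sum_filter_add_sum_filter_not ((oddQuadruples n).filter fun e => ¬ e.1.1 = e.2.1)
      (fun e => e.1.1 < e.2.1),
    Finset.filter_filter, Finset.filter_filter]
  have e1 : (oddQuadruples n).filter (fun e => ¬ e.1.1 = e.2.1 ∧ e.1.1 < e.2.1) =
      (oddQuadruples n).filter (fun e => e.1.1 < e.2.1) :=
    Finset.filter_congr fun e _ => by omega
  have e2 : (oddQuadruples n).filter (fun e => ¬ e.1.1 = e.2.1 ∧ ¬ e.1.1 < e.2.1) =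
      (oddQuadruples n).filter (fun e => e.2.1 < e.1.1) :=
    Finset.filter_congr fun e _ => by omega
  rw [e1, e2, h1, h2]
  linarith

/-- Representations of `n` as a sum of four squares. -/
def fourSquares (n : ℕ) : Set (ℤ × ℤ × ℤ × ℤ) :=
  {q | q.1 ^ 2 + q.2.1 ^ 2 + q.2.2.1 ^ 2 + q.2.2.2 ^ 2 = n}

theorem fourSquares_finite (n : ℕ) : (fourSquares n).Finite := by
  have hI := Set.finite_Icc (-(n : ℤ)) n
  refine (hI.prod (hI.prod (hI.prod hI))).subset ?_
  rintro ⟨a, b, c, e⟩ h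
  simp only [fourSquares, Set.mem_ofPred_eq] at h
  simp only [Set.mem_prod, Set.mem_Icc]
  have key : ∀ t : ℤ, t ^ 2 ≤ n → -(n : ℤ) ≤ t ∧ t ≤ n := fun t ht => by
    constructor <;> nlinarith [sq_nonneg t]
  refine ⟨key _ ?_, key _ ?_, key _ ?_, key _ ?_⟩ <;>
    nlinarith [sq_nonneg a, sq_nonneg b, sq_nonneg c, sq_nonneg e]

theorem gaussNorm_ncard_le_two_mul {u : ℕ} (hu : Odd u) :
    (gaussNorm u).ncard ≤ 2 * {z ∈ gaussNorm u | Odd z.re}.ncard := by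
  have hfin := gaussNorm_finite u
  have h1 : gaussNorm u ⊆ {z ∈ gaussNorm u | Odd z.re} ∪
      (fun z : GaussianInt => (⟨z.im, z.re⟩ : GaussianInt)) '' {z ∈ gaussNorm u | Odd z.re} := by
    intro z hz
    by_cases ho : Odd z.re
    · exact Or.inl ⟨hz, ho⟩
    · refine Or.inr ⟨⟨z.im, z.re⟩, ⟨?_, ?_⟩, rfl⟩
      · simp only [gaussNorm, Set.mem_ofPred_eq, Zsqrtd.norm_def] at hz ⊢
        linarith
      · simp only [gaussNorm, Set.mem_ofPred_eq, Zsqrtd.norm_def] at hz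
        have hz2 : z.re * z.re + z.im * z.im = u := by linarith
        have hu' : Odd (u : ℤ) := by exact_mod_cast hu
        rw [← hz2] at hu'
        rw [Int.odd_add, Int.odd_mul] at hu'
        by_contra hc
        exact ho ((hu'.2 ((Int.not_odd_iff_even.1 hc).mul_left _)).1)
  have hf2 : {z ∈ gaussNorm u | Odd z.re}.Finite := hfin.subset (Set.sep_subset _ _)
  calc (gaussNorm u).ncard ≤ _ := Set.ncard_le_ncard h1 (hf2.union (hf2.image _))
    _ ≤ _ := Set.ncard_union_le _ _
    _ ≤ _ := by
      have := Set.ncard_image_le (f := fun z : GaussianInt => (⟨z.im, z.re⟩ : GaussianInt)) hf2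
      omega

/-- A lower bound of the right order in Jacobi's four square theorem. -/
theorem le_ncard_fourSquares {n : ℕ} (hn : Odd n) : n ≤ 4 * (fourSquares n).ncard := by
  classical
  let A : ℕ → Finset GaussianInt := fun u =>
    ((gaussNorm_finite u).subset (Set.sep_subset _ (fun z => Odd z.re))).toFinset
  have hA : ∀ u z, z ∈ A u ↔ z.norm = u ∧ Odd z.re := fun u z => by simp [A, gaussNorm]
  have hAc : ∀ u, Odd u → chiDivisorSum u ≤ 2 * (A u).card := by
    intro u hu
    refine (chiDivisorSum_le_ncard u).trans ?_
    have := gaussNorm_ncard_le_two_mul hu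
    rw [Set.ncard_eq_toFinset_card _ ((gaussNorm_finite u).subset (Set.sep_subset _ _))] at this
    exact_mod_cast this
  let T := (Finset.HasAntidiagonal.antidiagonal (2 * n)).filter (fun uv => Odd uv.1)
  have hT : ∀ uv ∈ T, uv.1 + uv.2 = 2 * n ∧ Odd uv.1 ∧ Odd uv.2 := by
    intro uv huv
    simp only [T, Finset.mem_filter, Finset.HasAntidiagonal.mem_antidiagonal] at huv
    refine ⟨huv.1, huv.2, ?_⟩
    have := huv.1; have := huv.2
    rw [Nat.odd_iff] at *; omega
  have h1 : (n : ℤ) ≤ ∑ uv ∈ T, (2 * (A uv.1).card : ℤ) * (2 * (A uv.2).card) := by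
    refine (le_sum_chiDivisorSum hn).trans (Finset.sum_le_sum fun uv huv => ?_)
    obtain ⟨-, hu, hv⟩ := hT uv huv
    have hnn : ∀ u, 0 ≤ chiDivisorSum u := chiDivisorSum_nonneg
    exact mul_le_mul (hAc _ hu) (hAc _ hv) (hnn _) (by positivity)
  let D : Finset (Σ _ : ℕ × ℕ, GaussianInt × GaussianInt) := T.sigma fun uv => A uv.1 ×ˢ A uv.2
  have h2 : (n : ℤ) ≤ 4 * D.card := by
    rw [Finset.card_sigma]
    refine h1.trans (le_of_eq ?_)
    push_cast
    rw [Finset.mul_sum]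
    refine Finset.sum_congr rfl fun uv _ => ?_
    rw [Finset.card_product]; push_cast; ring
  have hD : ∀ q ∈ D, (Odd q.2.1.re ∧ Even q.2.1.im ∧ Odd q.2.2.re ∧ Even q.2.2.im) ∧
      q.2.1.norm = q.1.1 ∧ q.2.2.norm = q.1.2 ∧ q.1.1 + q.1.2 = 2 * n := by
    rintro ⟨uv, z, w⟩ hq
    simp only [D, Finset.mem_sigma, Finset.mem_product, hA] at hq
    obtain ⟨huv, ⟨hz, hz1⟩, hw, hw1⟩ := hq
    obtain ⟨hs, hu, hv⟩ := hT uv huv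
    have key : ∀ (z : GaussianInt) (u : ℕ), z.norm = u → Odd u → Odd z.re → Even z.im := by
      intro z u hz hu hzr
      have hu' : Odd (u : ℤ) := by exact_mod_cast hu
      rw [← hz, Zsqrtd.norm_def, show z.re * z.re - -1 * z.im * z.im =
        z.re * z.re + z.im * z.im by ring, Int.odd_add] at hu'
      have := hu'.1 (hzr.mul hzr)
      simpa [Int.even_mul] using this
    exact ⟨⟨hz1, key z _ hz hu hz1, hw1, key w _ hw hv hw1⟩, hz, hw, hs⟩
  have h3 : D.card ≤ (fourSquares n).ncard := by
    rw [← Set.ncard_coe_finset D]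
    refine Set.ncard_le_ncard_of_injOn (fun q => ((q.2.1.re + q.2.2.re) / 2,
      (q.2.1.re - q.2.2.re) / 2, (q.2.1.im + q.2.2.im) / 2, (q.2.1.im - q.2.2.im) / 2))
      ?_ ?_ (fourSquares_finite n)
    · rintro ⟨uv, z, w⟩ hq
      obtain ⟨⟨⟨a, ha⟩, ⟨b, hb⟩, ⟨c, hc⟩, ⟨e, he⟩⟩, hz, hw, hs⟩ := hD _ hq
      simp only [Zsqrtd.norm_def] at ha hb hc he hz hw hs ⊢
      simp only [fourSquares, Set.mem_ofPred_eq]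
      rw [ha, hb, hc, he] at *
      rw [show (2 * a + 1 + (2 * c + 1)) / 2 = a + c + 1 by omega,
        show (2 * a + 1 - (2 * c + 1)) / 2 = a - c by omega,
        show (b + b + (e + e)) / 2 = b + e by omega, show (b + b - (e + e)) / 2 = b - e by omega]
      have hs' : (uv.1 : ℤ) + uv.2 = 2 * n := by exact_mod_cast hs
      rw [← hz, ← hw] at hs'
      linarith
    · rintro ⟨⟨u, v⟩, z, w⟩ hq ⟨⟨u', v'⟩, z', w'⟩ hq' h
      obtain ⟨⟨⟨a, ha⟩, ⟨b, hb⟩, ⟨c, hc⟩, ⟨e, he⟩⟩, hz, hw, hs⟩ := hD _ hq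
      obtain ⟨⟨⟨a', ha'⟩, ⟨b', hb'⟩, ⟨c', hc'⟩, ⟨e', he'⟩⟩, hz', hw', hs'⟩ := hD _ hq'
      simp only [Prod.mk.injEq] at ha hb hc he hz hw hs ha' hb' hc' he' hz' hw' hs' h
      have hzz : z = z' := by ext <;> omega
      have hww : w = w' := by ext <;> omega
      subst hzz hww
      have e1 : u = u' := by exact_mod_cast hz.symm.trans hz'
      have e2 : v = v' := by exact_mod_cast hw.symm.trans hw'
      subst e1 e2
      rfl
  have : (n : ℤ) ≤ 4 * (fourSquares n).ncard := h2.trans (by exact_mod_cast Nat.mul_le_mul_left 4 h3)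
  exact_mod_cast this

theorem sph_finite (d lam : ℕ) : (sph d lam).Finite := by
  have hI : (Set.univ.pi fun _ : Fin d => Set.Icc (-(lam : ℤ)) lam).Finite :=
    Set.Finite.pi fun _ => Set.finite_Icc _ _
  refine (hI.prod hI).subset ?_
  rintro ⟨u, v⟩ h
  simp only [sph, Set.mem_ofPred_eq] at h
  have hu : 0 ≤ ∑ i, u i ^ 2 := Finset.sum_nonneg fun i _ => sq_nonneg _
  have hv : 0 ≤ ∑ i, v i ^ 2 := Finset.sum_nonneg fun i _ => sq_nonneg _
  have key : ∀ w : Fin d → ℤ, ∑ i, w i ^ 2 ≤ lam → ∀ i, -(lam : ℤ) ≤ w i ∧ w i ≤ lam := by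
    intro w hw i
    have := Finset.single_le_sum (f := fun i => w i ^ 2) (fun i _ => sq_nonneg _)
      (Finset.mem_univ i)
    constructor <;> nlinarith [sq_nonneg (w i)]
  simp only [Set.mem_prod, Set.mem_pi, Set.mem_univ, Set.mem_Icc, forall_true_left]
  exact ⟨key u (by linarith), key v (by linarith)⟩

theorem pow_mul_le_Ncount {j K lam : ℕ} (h : 16 * (j + 3) * K ^ 2 ≤ lam) :
    K ^ (2 * (j + 1)) * lam ≤ 8 * Ncount (j + 3) lam := by
  classical
  obtain ⟨ε, hε, hpar⟩ : ∃ ε : ℕ, ε ≤ 1 ∧ Odd (lam + ε) := by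
    rcases Nat.even_or_odd lam with he | ho
    · exact ⟨1, le_refl _, he.add_one⟩
    · exact ⟨0, by norm_num, ho⟩
  let I := Fin K × (Fin j → Fin K) × (Fin (j + 1) → Fin K)
  let s : I → ℕ := fun c => (2 * (c.1 : ℕ) + ε) ^ 2 + (∑ i, (2 * (c.2.1 i : ℕ)) ^ 2) +
    ∑ i, (2 * (c.2.2 i : ℕ)) ^ 2
  have hs : ∀ c, 2 * s c ≤ lam := by
    intro c
    have h0 : (2 * (c.1 : ℕ) + ε) ^ 2 ≤ 4 * K ^ 2 := by
      have := c.1.2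
      calc (2 * (c.1 : ℕ) + ε) ^ 2 ≤ (2 * K) ^ 2 := Nat.pow_le_pow_left (by omega) 2
        _ = _ := by ring
    have h1 : ∀ a : Fin K, (2 * (a : ℕ)) ^ 2 ≤ 4 * K ^ 2 := by
      intro a
      have := a.2
      calc (2 * (a : ℕ)) ^ 2 ≤ (2 * K) ^ 2 := Nat.pow_le_pow_left (by omega) 2
        _ = _ := by ring
    have h2 : ∑ i, (2 * (c.2.1 i : ℕ)) ^ 2 ≤ j * (4 * K ^ 2) := by
      simpa using Finset.sum_le_card_nsmul Finset.univ _ _ fun i _ => h1 (c.2.1 i)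
    have h3 : ∑ i, (2 * (c.2.2 i : ℕ)) ^ 2 ≤ (j + 1) * (4 * K ^ 2) := by
      simpa using Finset.sum_le_card_nsmul Finset.univ _ _ fun i _ => h1 (c.2.2 i)
    simp only [s]
    nlinarith
  have hodd : ∀ c, Odd (lam - s c) := by
    intro c
    have e : (s c) % 2 = ε % 2 := by
      have hs1 : ∀ {k} (f : Fin k → Fin K), (∑ i, (2 * (f i : ℕ)) ^ 2) % 2 = 0 := by
        intro k f
        exact Nat.mod_eq_zero_of_dvd (Finset.dvd_sum fun i _ =>
          dvd_pow (Dvd.intro _ rfl) (by norm_num))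
      have h0 : (2 * (c.1 : ℕ) + ε) ^ 2 % 2 = ε % 2 := by
        rw [Nat.pow_mod]
        interval_cases ε <;> simp [Nat.add_mod]
      simp only [s]
      have := hs1 c.2.1; have := hs1 c.2.2
      omega
    have := hs c
    rw [Nat.odd_iff] at *
    omega
  let D : Finset (Σ _ : I, ℤ × ℤ × ℤ × ℤ) :=
    Finset.univ.sigma fun c => (fourSquares_finite (lam - s c)).toFinset
  have h1 : K ^ (2 * (j + 1)) * lam ≤ 8 * D.card := by
    rw [Finset.card_sigma, Finset.mul_sum]
    have : ∀ c ∈ (Finset.univ : Finset I),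
        lam ≤ 8 * (fourSquares_finite (lam - s c)).toFinset.card := by
      intro c _
      rw [← Set.ncard_eq_toFinset_card _ (fourSquares_finite _)]
      have h1 := le_ncard_fourSquares (hodd c)
      have h2 := hs c
      omega
    have h2 := Finset.card_nsmul_le_sum _ _ _ this
    refine le_trans (le_of_eq ?_) h2
    simp only [Finset.card_univ, I, Fintype.card_prod, Fintype.card_fin, Fintype.card_fun,
      smul_eq_mul]
    ring
  refine h1.trans (Nat.mul_le_mul_left 8 ?_)
  rw [Ncount, Nat.card_coe_set_eq, ← Set.ncard_coe_finset D]
  refine Set.ncard_le_ncard_of_injOn (fun q =>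
    ((Fin.cons q.2.1 (Fin.cons q.2.2.1 (Fin.cons (2 * (q.1.1 : ℕ) + ε : ℤ)
      (fun i => 2 * ((q.1.2.1 i : ℕ) : ℤ)))) : V (j + 3)),
     (Fin.cons q.2.2.2.1 (Fin.cons q.2.2.2.2 (fun i => 2 * ((q.1.2.2 i : ℕ) : ℤ))) : V (j + 3))))
    ?_ ?_ (sph_finite _ _)
  · rintro ⟨c, x, y, z, w⟩ hq
    simp only [D, Finset.coe_sigma, Set.mem_sigma_iff, Finset.mem_coe, Set.Finite.mem_toFinset,
      fourSquares, Set.mem_ofPred_eq] at hq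
    have hq2 := hq.2
    have hle : s c ≤ lam := by have := hs c; omega
    rw [Nat.cast_sub hle] at hq2
    simp only [sph, Set.mem_ofPred_eq]
    simp only [Fin.sum_univ_succ (n := j + 2), Fin.sum_univ_succ (n := j + 1),
      Fin.sum_univ_succ (n := j), Fin.cons_zero, Fin.cons_succ]
    have e : (s c : ℤ) = (2 * ((c.1 : ℕ) : ℤ) + ε) ^ 2 + (∑ i, (2 * ((c.2.1 i : ℕ) : ℤ)) ^ 2) +
      ((2 * ((c.2.2 0 : ℕ) : ℤ)) ^ 2 + ∑ i : Fin j, (2 * ((c.2.2 i.succ : ℕ) : ℤ)) ^ 2) := by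
      simp only [s]
      rw [Fin.sum_univ_succ (n := j)]
      push_cast; ring
    rw [e] at hq2
    linarith
  · rintro ⟨⟨a, c, e⟩, x, y, z, w⟩ - ⟨⟨a', c', e'⟩, x', y', z', w'⟩ - h
    obtain ⟨hu, hv⟩ := Prod.mk.inj h
    obtain ⟨rfl, hu⟩ := Fin.cons_inj.1 hu
    obtain ⟨rfl, hu⟩ := Fin.cons_inj.1 hu
    obtain ⟨ha, hc⟩ := Fin.cons_inj.1 hu
    obtain ⟨rfl, hv⟩ := Fin.cons_inj.1 hv
    obtain ⟨rfl, he⟩ := Fin.cons_inj.1 hv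
    have h1 : a = a' := by ext; dsimp only at ha; omega
    have h2 : c = c' := by ext i; have := congrFun hc i; dsimp only at this; omega
    have h3 : e = e' := by ext i; have := congrFun he i; dsimp only at this; omega
    subst h1 h2 h3
    rfl

theorem exists_le_Ncount {d : ℕ} (hd : 3 ≤ d) :
    ∃ c : ℝ, 0 < c ∧ ∀ lam : ℕ, 0 < Ncount d lam → c * (lam + 1 : ℝ) ^ (d - 1) ≤ Ncount d lam := by
  obtain ⟨j, rfl⟩ : ∃ j, d = j + 3 := ⟨d - 3, by omega⟩
  set A : ℝ := 16 * (j + 3) with hA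
  have hA0 : 16 ≤ A := by rw [hA]; have : (0 : ℝ) ≤ j := by positivity
                          linarith
  refine ⟨1 / (8 * (8 * A) ^ (j + 2)), by positivity, fun lam hpos => ?_⟩
  rw [show j + 3 - 1 = j + 2 by omega]
  have hN : (1 : ℝ) ≤ Ncount (j + 3) lam := by exact_mod_cast hpos
  by_cases hl : 16 * (j + 3) ≤ lam
  · set K := Nat.sqrt (lam / (16 * (j + 3)))
    have hK1 : 1 ≤ K := by
      rw [Nat.le_sqrt']
      rw [Nat.le_div_iff_mul_le (by positivity)]; omega
    have hK : 16 * (j + 3) * K ^ 2 ≤ lam := by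
      have : K ^ 2 ≤ lam / (16 * (j + 3)) := Nat.sqrt_le' _
      rw [Nat.le_div_iff_mul_le (by positivity)] at this
      linarith
    have hK2 : lam + 1 ≤ 16 * (j + 3) * (K + 1) ^ 2 := by
      have : lam / (16 * (j + 3)) < (K + 1) ^ 2 := Nat.lt_succ_sqrt' _
      rw [Nat.div_lt_iff_lt_mul (by positivity)] at this
      linarith
    have h := pow_mul_le_Ncount hK
    have h' : (K : ℝ) ^ (2 * (j + 1)) * lam ≤ 8 * Ncount (j + 3) lam := by exact_mod_cast h
    have hK2' : (lam + 1 : ℝ) ≤ A * (K + 1) ^ 2 := by rw [hA]; exact_mod_cast hK2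
    have hK1' : (1 : ℝ) ≤ K := by exact_mod_cast hK1
    have hlam : (lam + 1 : ℝ) ≤ (8 * A) * K ^ 2 := by
      have : (K + 1 : ℝ) ^ 2 ≤ 4 * K ^ 2 := by nlinarith
      nlinarith
    have hlam2 : (lam + 1 : ℝ) ≤ 8 * A * lam := by
      have : (1 : ℝ) ≤ lam := by exact_mod_cast (by omega : 1 ≤ lam)
      nlinarith
    rw [div_mul_eq_mul_div, one_mul, div_le_iff₀ (by positivity)]
    calc (lam + 1 : ℝ) ^ (j + 2) = (lam + 1 : ℝ) ^ (j + 1) * (lam + 1) := pow_succ _ _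
      _ ≤ ((8 * A) * K ^ 2) ^ (j + 1) * (8 * A * lam) := by gcongr
      _ = (8 * A) ^ (j + 2) * (K ^ (2 * (j + 1)) * lam) := by rw [mul_pow, ← pow_mul]; ring
      _ ≤ (8 * A) ^ (j + 2) * (8 * Ncount (j + 3) lam) := by gcongr
      _ = _ := by ring
  · refine le_trans ?_ hN
    rw [div_mul_eq_mul_div, one_mul, div_le_one (by positivity)]
    have : (lam + 1 : ℝ) ≤ 8 * A := by
      have : lam + 1 ≤ 16 * (j + 3) := by omega
      have : (lam + 1 : ℝ) ≤ A := by rw [hA]; exact_mod_cast this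
      linarith
    calc (lam + 1 : ℝ) ^ (j + 2) ≤ (8 * A) ^ (j + 2) := by gcongr
      _ ≤ _ := by
        have : 0 ≤ (8 * A) ^ (j + 2) := by positivity
        linarith

open Complex in
/-- The sum of the fourth powers of the absolute values of the three theta constants. -/
def thetaQuartic (τ : ℂ) : ℝ :=
  ‖jacobiTheta₂ 0 τ‖ ^ 4 + ‖jacobiTheta₂ (1 / 2) τ‖ ^ 4 +
    ‖cexp (Real.pi * I * τ / 4) * jacobiTheta₂ (τ / 2) τ‖ ^ 4

open Complex in
theorem jacobiTheta₂_add_one_right (z τ : ℂ) :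
    jacobiTheta₂ z (τ + 1) = jacobiTheta₂ (z + 1 / 2) τ := by
  refine tsum_congr fun n => ?_
  rw [jacobiTheta₂_term, jacobiTheta₂_term, Complex.exp_eq_exp_iff_exists_int]
  obtain ⟨k, hk⟩ := Int.even_mul_pred_self n
  refine ⟨k, ?_⟩
  have : (n : ℂ) * (n - 1) = k + k := by exact_mod_cast hk
  linear_combination (Real.pi * I) * this

open Complex in
theorem thetaQuartic_add_one (τ : ℂ) : thetaQuartic (τ + 1) = thetaQuartic τ := by
  have h1 : jacobiTheta₂ 1 τ = jacobiTheta₂ 0 τ := by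
    simpa using jacobiTheta₂_add_left 0 τ
  have h2 : jacobiTheta₂ ((τ + 1) / 2 + 1 / 2) τ = jacobiTheta₂ (τ / 2) τ := by
    rw [← jacobiTheta₂_add_left (τ / 2)]
    ring_nf
  have h3 : ‖cexp (Real.pi * I * (τ + 1) / 4)‖ = ‖cexp (Real.pi * I * τ / 4)‖ := by
    rw [norm_exp, norm_exp]
    congr 1
    simp [mul_add, add_div, mul_assoc]
  simp only [thetaQuartic, jacobiTheta₂_add_one_right, norm_mul, h2, h3]
  norm_num [h1]
  ring

open Complex in
theorem norm_jacobiTheta₂_pow_four (z : ℂ) {τ : ℂ} (hτ : τ ≠ 0) :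
    ‖τ‖ ^ 2 * ‖jacobiTheta₂ z τ‖ ^ 4 =
      ‖cexp (-Real.pi * I * z ^ 2 / τ) * jacobiTheta₂ (z / τ) (-1 / τ)‖ ^ 4 := by
  have h0 : -I * τ ≠ 0 := by simp [hτ]
  have h : ‖(-I * τ) ^ (1 / 2 : ℂ)‖ ^ 4 = ‖τ‖ ^ 2 := by
    rw [← norm_pow, ← cpow_nat_mul, ← norm_pow]
    norm_num
  conv_lhs => rw [jacobiTheta₂_functional_equation, mul_assoc, norm_mul, mul_pow, norm_div,
    div_pow, h]
  have : ‖τ‖ ≠ 0 := by simpa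
  field_simp
  simp

open Complex in
theorem thetaQuartic_neg_one_div {τ : ℂ} (hτ : τ ≠ 0) :
    thetaQuartic (-1 / τ) = ‖τ‖ ^ 2 * thetaQuartic τ := by
  have h1 := norm_jacobiTheta₂_pow_four 0 hτ
  have h2 := norm_jacobiTheta₂_pow_four (1 / 2) hτ
  have h3 := norm_jacobiTheta₂_pow_four (τ / 2) hτ
  rw [thetaQuartic, thetaQuartic, mul_add, mul_add, h1, h2, norm_mul _ (jacobiTheta₂ (τ / 2) τ),
    mul_pow _ _ 4, mul_left_comm, h3, ← mul_pow, ← norm_mul, ← mul_assoc, ← Complex.exp_add]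
  have e1 : (Real.pi : ℂ) * I * τ / 4 + -Real.pi * I * (τ / 2) ^ 2 / τ = 0 := by field_simp; ring
  have e2 : τ / 2 / τ = 1 / 2 := by field_simp
  have e3 : jacobiTheta₂ (1 / 2 / τ) (-1 / τ) = jacobiTheta₂ (-1 / τ / 2) (-1 / τ) := by
    rw [← jacobiTheta₂_neg_left]; ring_nf
  have e4 : -(Real.pi : ℂ) * I * (1 / 2) ^ 2 / τ = Real.pi * I * (-1 / τ) / 4 := by ring
  rw [e1, e2, e3, e4]
  simp
  ring

open Complex UpperHalfPlane ModularGroup MatrixGroups in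
theorem im_mul_thetaQuartic_smul (g : SL(2, ℤ)) (τ : ℍ) :
    (g • τ).im * thetaQuartic (g • τ : ℍ) = τ.im * thetaQuartic τ := by
  have hS : ∀ τ : ℍ, (S • τ).im * thetaQuartic (S • τ : ℍ) = τ.im * thetaQuartic τ := by
    intro τ
    rw [modular_S_smul]
    have e : ((UpperHalfPlane.mk (-τ : ℂ)⁻¹ τ.im_inv_neg_coe_pos : ℍ) : ℂ) = -1 / (τ : ℂ) := by
      show (-(τ : ℂ))⁻¹ = -1 / τ
      rw [← one_div, neg_div, div_neg]
    have h1 : (UpperHalfPlane.mk (-τ : ℂ)⁻¹ τ.im_inv_neg_coe_pos : ℍ).im =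
        τ.im / ‖(τ : ℂ)‖ ^ 2 := by
      rw [← UpperHalfPlane.coe_im, e, ← normSq_eq_norm_sq, neg_div, one_div, neg_im, inv_im]
      simp [neg_div]
    rw [h1, e, thetaQuartic_neg_one_div τ.ne_zero]
    have : ‖(τ : ℂ)‖ ≠ 0 := by simpa using τ.ne_zero
    field_simp
  have hT : ∀ τ : ℍ, (T • τ).im * thetaQuartic (T • τ : ℍ) = τ.im * thetaQuartic τ := by
    intro τ
    rw [modular_T_smul, vadd_im, coe_vadd, ofReal_one, add_comm, thetaQuartic_add_one]
  have hg : g ∈ Subgroup.closure {S, T} := by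
    rw [SpecialLinearGroup.SL2Z_generators]; trivial
  induction hg using Subgroup.closure_induction generalizing τ with
  | mem x hx =>
    rcases hx with rfl | rfl
    · exact hS τ
    · exact hT τ
  | one => simp
  | mul x y _ _ hx hy => rw [mul_smul, hx, hy]
  | inv x _ hx => rw [← hx (x⁻¹ • τ), smul_inv_smul]

open Complex in
theorem exists_thetaQuartic_le : ∃ K : ℝ, ∀ τ : ℂ, 1 / 2 ≤ τ.im → thetaQuartic τ ≤ K := by
  have hs : Summable fun n : ℤ => ‖jacobiTheta₂_term n 0 (I / 8)‖ :=
    ((summable_jacobiTheta₂_term_iff 0 (I / 8)).2 (by simp)).norm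
  set M := ∑' n : ℤ, ‖jacobiTheta₂_term n 0 (I / 8)‖
  have key : ∀ τ : ℂ, 1 / 2 ≤ τ.im → ∀ f : ℤ → ℂ,
      (∀ n : ℤ, ‖f n‖ ≤ Real.exp (-Real.pi * (n ^ 2 / 4) * τ.im)) → ‖∑' n, f n‖ ^ 4 ≤ M ^ 4 := by
    intro τ hτ f hf
    have hf' : ∀ n, ‖f n‖ ≤ ‖jacobiTheta₂_term n 0 (I / 8)‖ := by
      intro n
      refine (hf n).trans ?_
      rw [norm_jacobiTheta₂_term]
      apply Real.exp_le_exp.2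
      have : (I / 8).im = 1 / 8 := by simp
      rw [this]
      have h1 : 0 ≤ Real.pi * n ^ 2 := by positivity
      simp only [zero_im, mul_zero, sub_zero]
      nlinarith
    have := tsum_of_norm_bounded hs.hasSum hf'
    gcongr
  refine ⟨M ^ 4 + M ^ 4 + M ^ 4, fun τ hτ => ?_⟩
  have hb : ∀ (x : ℝ) (n : ℤ), (n : ℝ) ^ 2 / 4 ≤ x →
      Real.exp (-Real.pi * x * τ.im) ≤ Real.exp (-Real.pi * (n ^ 2 / 4) * τ.im) := by
    intro x n hx
    apply Real.exp_le_exp.2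
    have := mul_le_mul_of_nonneg_left hx (by positivity : 0 ≤ Real.pi * τ.im)
    nlinarith
  refine add_le_add (add_le_add ?_ ?_) ?_
  · refine key τ hτ _ fun n => ?_
    rw [norm_jacobiTheta₂_term]
    simp only [zero_im, mul_zero, sub_zero]
    exact hb _ n (by nlinarith [sq_nonneg (n : ℝ)])
  · refine key τ hτ _ fun n => ?_
    rw [norm_jacobiTheta₂_term]
    have : (1 / 2 : ℂ).im = 0 := by simp
    simp only [this, mul_zero, sub_zero]
    exact hb _ n (by nlinarith [sq_nonneg (n : ℝ)])
  · rw [jacobiTheta₂, ← tsum_mul_left]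
    refine key τ hτ _ fun n => ?_
    rw [norm_mul, norm_jacobiTheta₂_term, norm_exp, ← Real.exp_add]
    have e : (Real.pi * I * τ / 4).re + (-Real.pi * n ^ 2 * τ.im - 2 * Real.pi * n * (τ / 2).im) =
        -Real.pi * ((n : ℝ) + 1 / 2) ^ 2 * τ.im := by
      have h1 : (Real.pi * I * τ / 4).re = -Real.pi * τ.im / 4 := by simp
      have h2 : (τ / 2).im = τ.im / 2 := by simp
      rw [h1, h2]; ring
    rw [e]
    apply hb
    have : 0 ≤ (3 * n + 1) * (n + 1) := by
      rcases le_or_gt 0 n with h | h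
      · positivity
      · exact mul_nonneg_of_nonpos_of_nonpos (by omega) (by omega)
    have : (0 : ℝ) ≤ (3 * n + 1) * (n + 1) := by exact_mod_cast this
    nlinarith

open Complex UpperHalfPlane ModularGroup MatrixGroups in
theorem exists_norm_jacobiTheta_pow_four_mul_le : ∃ K : ℝ, 0 < K ∧ ∀ τ : ℍ, ∃ a b : ℤ,
    IsCoprime a b ∧ ‖jacobiTheta τ‖ ^ 4 * normSq (a * τ + b) ≤ K := by
  obtain ⟨K, hK⟩ := exists_thetaQuartic_le
  refine ⟨max K 1, by positivity, fun τ => ?_⟩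
  obtain ⟨g, hg⟩ := exists_smul_mem_fd τ
  have him : 1 / 2 ≤ (g • τ).im := by
    have := three_le_four_mul_im_sq_of_mem_fd hg
    have := (g • τ).im_pos
    nlinarith
  have hinv := im_mul_thetaQuartic_smul g τ
  have hd : (g • τ).im = τ.im / normSq (g 1 0 * τ + g 1 1) := by
    rw [ModularGroup.im_smul_eq_div_normSq, denom_apply]
  have hN : 0 < normSq (g 1 0 * τ + g 1 1) := by
    rw [← denom_apply]; exact normSq_denom_pos _ τ.im_ne_zero
  have him0 := τ.im_pos
  have h1 : ‖jacobiTheta τ‖ ^ 4 ≤ thetaQuartic τ := by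
    rw [jacobiTheta_eq_jacobiTheta₂, thetaQuartic, add_assoc]
    exact le_add_of_nonneg_right (by positivity)
  have h2 : thetaQuartic τ * normSq (g 1 0 * τ + g 1 1) = thetaQuartic (g • τ : ℍ) := by
    rw [hd] at hinv
    field_simp at hinv
    linarith
  refine ⟨g 1 0, g 1 1, Matrix.SpecialLinearGroup.isCoprime_row g 1, ?_⟩
  calc _ ≤ thetaQuartic τ * normSq (g 1 0 * τ + g 1 1) := by gcongr
    _ = _ := h2
    _ ≤ K := hK _ him
    _ ≤ _ := le_max_left _ _

open Complex in
theorem exists_norm_jacobiTheta_pow_four_mul_le' : ∃ K : ℝ, 0 < K ∧ ∀ x y : ℝ, 0 < y → ∃ a b : ℤ,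
    (a ≠ 0 ∨ 1 ≤ b ^ 2) ∧
      ‖jacobiTheta (x + y * I)‖ ^ 4 * ((a * x + b) ^ 2 + (a * y) ^ 2) ≤ K := by
  obtain ⟨K, hK, h⟩ := exists_norm_jacobiTheta_pow_four_mul_le
  refine ⟨K, hK, fun x y hy => ?_⟩
  obtain ⟨a, b, hab, hle⟩ := h ⟨x + y * I, by simpa using hy⟩
  refine ⟨a, b, ?_, ?_⟩
  · by_contra! h0
    obtain ⟨rfl, hb⟩ := h0
    have : b = 0 := by
      by_contra hb0
      have := sq_pos_of_ne_zero hb0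
      omega
    subst this
    exact not_isUnit_zero (isCoprime_zero_left.1 hab)
  · refine le_trans (le_of_eq ?_) hle
    congr 1
    rw [normSq_apply]
    simp
    ring

open Complex in
theorem exists_norm_jacobiTheta_pow_four_le : ∃ K : ℝ, 0 < K ∧ ∀ x y : ℝ, 0 < y → y ≤ 1 →
    ‖jacobiTheta (x + y * I)‖ ^ 4 ≤ K / y ^ 2 := by
  obtain ⟨K, hK, h⟩ := exists_norm_jacobiTheta_pow_four_mul_le'
  refine ⟨K, hK, fun x y hy hy1 => ?_⟩
  obtain ⟨a, b, hab, hle⟩ := h x y hy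
  rw [le_div_iff₀ (by positivity)]
  refine le_trans ?_ hle
  gcongr
  by_cases ha : a = 0
  · subst ha
    have : (1 : ℝ) ≤ b ^ 2 := by exact_mod_cast hab.resolve_left (by simp)
    simp
    nlinarith
  · have : (1 : ℝ) ≤ a ^ 2 := by exact_mod_cast Int.one_le_abs (pow_ne_zero 2 ha) |>.trans (by simp)
    nlinarith [sq_nonneg (a * x + b)]

open Complex MeasureTheory in
theorem exists_volume_lt_norm_jacobiTheta_le : ∃ C : ℝ, 0 < C ∧ ∀ y t : ℝ, 0 < y → y ≤ 1 → 0 < t →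
    volume {x ∈ Set.Ioc (0 : ℝ) 2 | t < ‖jacobiTheta (x + y * I)‖} ≤
      ENNReal.ofReal (C / (y * t ^ 4)) := by
  obtain ⟨K, hK, h⟩ := exists_norm_jacobiTheta_pow_four_mul_le'
  refine ⟨28 * K, by positivity, fun y t hy hy1 ht => ?_⟩
  by_cases htK : t ^ 4 ≤ K
  · refine (measure_mono (Set.sep_subset _ _)).trans ?_
    rw [Real.volume_Ioc]
    apply ENNReal.ofReal_le_ofReal
    rw [le_div_iff₀ (by positivity)]
    nlinarith [mul_le_mul hy1 htK (by positivity) zero_le_one]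
  push Not at htK
  set δ := √K / t ^ 2 with hδ
  have hδ0 : 0 < δ := by positivity
  have hδ2 : δ ^ 2 * t ^ 4 = K := by
    rw [hδ, div_pow, Real.sq_sqrt hK.le]
    field_simp
  have hδ1 : δ < 1 := by
    by_contra! h1
    have : 1 ≤ δ ^ 2 := by nlinarith
    nlinarith [pow_pos ht 4]
  set M := ⌊δ / y⌋ with hM
  have hM0 : 0 ≤ M := Int.floor_nonneg.2 (by positivity)
  let J : Finset (Σ _ : ℤ, ℤ) :=
    ((Finset.Icc (-M) M).erase 0).sigma fun a => Finset.Icc (-(3 * |a|)) (3 * |a|)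
  have hsub : {x ∈ Set.Ioc (0 : ℝ) 2 | t < ‖jacobiTheta (x + y * I)‖} ⊆
      ⋃ q ∈ J, Metric.closedBall (-(q.2 : ℝ) / q.1) (δ / |(q.1 : ℝ)|) := by
    rintro x ⟨⟨hx0, hx2⟩, hx⟩
    obtain ⟨a, b, hab, hle⟩ := h x y hy
    have hle' : t ^ 4 * ((a * x + b) ^ 2 + (a * y) ^ 2) ≤ t ^ 4 * δ ^ 2 := by
      rw [mul_comm _ (δ ^ 2), hδ2]
      exact le_trans (by gcongr) hle
    have hle2 := le_of_mul_le_mul_left hle' (by positivity)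
    have ha : a ≠ 0 := by
      rintro rfl
      have : (1 : ℝ) ≤ b ^ 2 := by exact_mod_cast hab.resolve_left (by simp)
      simp at hle2
      nlinarith
    have ha1 : (1 : ℝ) ≤ |(a : ℝ)| := by exact_mod_cast Int.one_le_abs ha
    have h1 : |a * x + b| ≤ δ := abs_le_of_sq_le_sq (by nlinarith [sq_nonneg (a * y)]) hδ0.le
    have h2 : |(a : ℝ)| * y ≤ δ := by
      rw [← abs_of_pos hy, ← abs_mul]
      exact abs_le_of_sq_le_sq (by nlinarith [sq_nonneg (a * x + b)]) hδ0.le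
    have h3 : |a| ≤ M := by
      rw [hM, Int.le_floor, le_div_iff₀ hy]
      exact_mod_cast h2
    have h4 : |b| ≤ 3 * |a| := by
      have : |(b : ℝ)| ≤ 3 * |(a : ℝ)| := by
        calc |(b : ℝ)| = |(a * x + b) - a * x| := by ring_nf
          _ ≤ |a * x + b| + |a * x| := abs_sub _ _
          _ ≤ 1 + |(a : ℝ)| * 2 := by
            rw [abs_mul, abs_of_pos hx0]
            gcongr
            linarith
          _ ≤ _ := by linarith
      exact_mod_cast this
    simp only [Set.mem_iUnion, exists_prop]
    refine ⟨⟨a, b⟩, ?_, ?_⟩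
    · simp only [J, Finset.mem_sigma, Finset.mem_erase, Finset.mem_Icc]
      exact ⟨⟨ha, abs_le.1 h3⟩, abs_le.1 h4⟩
    · have ha0 : (a : ℝ) ≠ 0 := by exact_mod_cast ha
      rw [Metric.mem_closedBall, Real.dist_eq, le_div_iff₀ (by positivity), ← abs_mul]
      refine le_trans (le_of_eq ?_) h1
      congr 1
      field_simp
      ring
  refine (measure_mono hsub).trans ((measure_biUnion_finset_le _ _).trans ?_)
  simp only [Real.volume_closedBall]
  rw [← ENNReal.ofReal_sum_of_nonneg fun _ _ => by positivity]
  apply ENNReal.ofReal_le_ofReal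
  rw [Finset.sum_sigma]
  have hin : ∀ a ∈ (Finset.Icc (-M) M).erase 0,
      ∑ b ∈ Finset.Icc (-(3 * |a|)) (3 * |a|), 2 * (δ / |(a : ℝ)|) ≤ 14 * δ := by
    intro a ha
    have ha0 : a ≠ 0 := (Finset.mem_erase.1 ha).1
    have ha1 : (1 : ℝ) ≤ |(a : ℝ)| := by exact_mod_cast Int.one_le_abs ha0
    rw [Finset.sum_const, Int.card_Icc, nsmul_eq_mul]
    have hc : ((3 * |a| + 1 - -(3 * |a|)).toNat : ℝ) = 6 * |(a : ℝ)| + 1 := by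
      have : ((3 * |a| + 1 - -(3 * |a|)).toNat : ℤ) = 6 * |a| + 1 := by
        have := abs_nonneg a
        omega
      exact_mod_cast this
    rw [hc]
    have : 2 * (δ / |(a : ℝ)|) * |(a : ℝ)| = 2 * δ := by field_simp
    have h2 : 0 ≤ 2 * (δ / |(a : ℝ)|) := by positivity
    nlinarith
  refine (Finset.sum_le_sum hin).trans ?_
  rw [Finset.sum_const, nsmul_eq_mul, Finset.card_erase_of_mem (by simpa using hM0), Int.card_Icc]
  have hc : (((M + 1 - -M).toNat - 1 : ℕ) : ℝ) = 2 * M := by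
    have : (((M + 1 - -M).toNat - 1 : ℕ) : ℤ) = 2 * M := by omega
    exact_mod_cast this
  rw [hc]
  have hMle : (M : ℝ) ≤ δ / y := Int.floor_le _
  calc 2 * (M : ℝ) * (14 * δ) ≤ 2 * (δ / y) * (14 * δ) := by gcongr
    _ = 28 * K / (y * t ^ 4) := by rw [← hδ2]; field_simp; ring

open MeasureTheory Set in
theorem lintegral_pow_five_le {α : Type*} [MeasurableSpace α] (μ : Measure α) {f : α → ℝ}
    (hf0 : 0 ≤ f) (hf : AEMeasurable f μ) {A T : ℝ} (hA : 0 ≤ A) (hfT : ∀ x, f x ≤ T)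
    (h : ∀ t, 0 < t → μ {x | t < f x} ≤ ENNReal.ofReal (A / t ^ 4)) :
    ∫⁻ x, ENNReal.ofReal (f x ^ 5) ∂μ ≤ ENNReal.ofReal (5 * A * T) := by
  have h1 := lintegral_rpow_eq_lintegral_meas_lt_mul μ (.of_forall hf0) hf (p := 5) (by norm_num)
  rw [show (5 : ℝ) = ((5 : ℕ) : ℝ) by norm_num] at h1
  simp only [Real.rpow_natCast] at h1
  rw [h1, mul_assoc, ENNReal.ofReal_mul (by norm_num)]
  gcongr
  · norm_num
  calc ∫⁻ t in Ioi (0 : ℝ), μ {x | t < f x} * ENNReal.ofReal (t ^ (((5 : ℕ) : ℝ) - 1))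
      ≤ ∫⁻ t in Ioi (0 : ℝ), (Ioc 0 T).indicator (fun _ => ENNReal.ofReal A) t := by
        refine setLIntegral_mono' measurableSet_Ioi fun t ht => ?_
        have ht : 0 < t := ht
        by_cases htT : t ≤ T
        · rw [indicator_of_mem (show t ∈ Ioc 0 T from ⟨ht, htT⟩)]
          refine (mul_le_mul_left (h t ht) _).trans ?_
          rw [← ENNReal.ofReal_mul (by positivity)]
          apply ENNReal.ofReal_le_ofReal
          rw [show ((5 : ℕ) : ℝ) - 1 = ((4 : ℕ) : ℝ) by norm_num, Real.rpow_natCast]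
          field_simp
          rfl
        · have : {x | t < f x} = ∅ := by
            ext x
            simpa using (hfT x).trans (not_le.1 htT).le
          rw [this]
          simp
    _ ≤ ∫⁻ t, (Ioc 0 T).indicator (fun _ => ENNReal.ofReal A) t := setLIntegral_le_lintegral _ _
    _ = ENNReal.ofReal (A * T) := by
        rw [lintegral_indicator measurableSet_Ioc, setLIntegral_const, Real.volume_Ioc, sub_zero,
          ENNReal.ofReal_mul hA]

open MeasureTheory Set in
theorem lintegral_pow_three_le {α : Type*} [MeasurableSpace α] (μ : Measure α) {f : α → ℝ}
    (hf0 : 0 ≤ f) (hf : AEMeasurable f μ) {A B H : ℝ} (hA : 0 ≤ A) (hB : 0 ≤ B) (hH : 0 < H)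
    (h1 : ∀ t, 0 < t → t ≤ H → μ {x | t < f x} ≤ ENNReal.ofReal (A / t ^ 2))
    (h2 : ∀ t, H < t → μ {x | t < f x} ≤ ENNReal.ofReal (B / t ^ 4)) :
    ∫⁻ x, ENNReal.ofReal (f x ^ 3) ∂μ ≤ ENNReal.ofReal (3 * (A * H + B / H)) := by
  have h0 := lintegral_rpow_eq_lintegral_meas_lt_mul μ (.of_forall hf0) hf (p := 3) (by norm_num)
  rw [show (3 : ℝ) = ((3 : ℕ) : ℝ) by norm_num] at h0
  simp only [Real.rpow_natCast] at h0
  have e : ∀ t : ℝ, t ^ (((3 : ℕ) : ℝ) - 1) = t ^ 2 := fun t => by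
    rw [show ((3 : ℕ) : ℝ) - 1 = ((2 : ℕ) : ℝ) by norm_num, Real.rpow_natCast]
  simp only [e] at h0
  rw [h0, ENNReal.ofReal_mul (by norm_num), ENNReal.ofReal_add (by positivity) (by positivity),
    ← Ioc_union_Ioi_eq_Ioi hH.le]
  gcongr
  · norm_num
  refine (lintegral_union_le _ _ _).trans (add_le_add ?_ ?_)
  · calc ∫⁻ t in Ioc 0 H, μ {x | t < f x} * ENNReal.ofReal (t ^ 2)
        ≤ ∫⁻ t in Ioc 0 H, ENNReal.ofReal A := by
          refine setLIntegral_mono' measurableSet_Ioc fun t ht' => ?_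
          obtain ⟨ht, htH⟩ := ht'
          refine (mul_le_mul_left (h1 t ht htH) _).trans ?_
          rw [← ENNReal.ofReal_mul (by positivity)]
          apply ENNReal.ofReal_le_ofReal
          field_simp
          rfl
      _ = _ := by rw [setLIntegral_const, Real.volume_Ioc, sub_zero, ENNReal.ofReal_mul hA]
  · calc ∫⁻ t in Ioi H, μ {x | t < f x} * ENNReal.ofReal (t ^ 2)
        ≤ ∫⁻ t in Ioi H, ENNReal.ofReal (B * t ^ (-2 : ℝ)) := by
          refine setLIntegral_mono' measurableSet_Ioi fun t htH => ?_
          have htH : H < t := htH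
          have ht : 0 < t := hH.trans htH
          refine (mul_le_mul_left (h2 t htH) _).trans ?_
          rw [← ENNReal.ofReal_mul (by positivity)]
          apply ENNReal.ofReal_le_ofReal
          rw [Real.rpow_neg ht.le, show (2 : ℝ) = ((2 : ℕ) : ℝ) by norm_num, Real.rpow_natCast]
          field_simp
          rfl
      _ = _ := by
          rw [← ofReal_integral_eq_lintegral_ofReal
            ((integrableOn_Ioi_rpow_of_lt (by norm_num) hH).const_mul _)]
          · rw [integral_const_mul, integral_Ioi_rpow_of_lt (by norm_num) hH]
            norm_num [Real.rpow_neg_one]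
            rfl
          · filter_upwards [ae_restrict_mem measurableSet_Ioi] with t ht
            have : 0 < t := hH.trans ht
            show 0 ≤ B * t ^ (-2 : ℝ)
            positivity

/-- The squared Euclidean length of a lattice point. -/
def normSqNat {d : ℕ} (v : V d) : ℕ := ∑ i, (v i).natAbs ^ 2

theorem natCast_normSqNat {d : ℕ} (v : V d) : (normSqNat v : ℤ) = ∑ i, v i ^ 2 := by
  simp [normSqNat]

theorem normSqNat_cons {d : ℕ} (a : ℤ) (v : V d) :
    normSqNat (Fin.cons a v : V (d + 1)) = a.natAbs ^ 2 + normSqNat v := by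
  simp [normSqNat, Fin.sum_univ_succ]

open Complex in
theorem norm_cexp_pi_mul_I (n : ℕ) (τ : ℂ) :
    ‖cexp (Real.pi * I * n * τ)‖ = Real.exp (-Real.pi * n * τ.im) := by
  rw [norm_exp]
  congr 1
  have : (Real.pi * I * n * τ : ℂ) = ((Real.pi * n : ℝ) : ℂ) * (I * τ) := by push_cast; ring
  rw [this, re_ofReal_mul]
  simp

open Complex in
theorem hasSum_jacobiTheta_pow (d : ℕ) {τ : ℂ} (hτ : 0 < τ.im) :
    HasSum (fun v : V d => cexp (Real.pi * I * normSqNat v * τ)) (jacobiTheta τ ^ d) ∧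
      Summable fun v : V d => ‖cexp (Real.pi * I * normSqNat v * τ)‖ := by
  induction d with
  | zero =>
    refine ⟨?_, Summable.of_finite⟩
    convert hasSum_unique (fun v : V 0 => cexp (Real.pi * I * normSqNat v * τ)) using 1
    simp [normSqNat]
  | succ d ih =>
    obtain ⟨h1, h2⟩ := ih
    have e : ∀ n : ℤ, jacobiTheta₂_term n 0 τ = cexp (Real.pi * I * (n.natAbs ^ 2 : ℕ) * τ) := by
      intro n
      have : (((n.natAbs ^ 2 : ℕ) : ℤ) : ℂ) = ((n ^ 2 : ℤ) : ℂ) := by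
        rw [Nat.cast_pow, Int.natAbs_sq]
      rw [jacobiTheta₂_term, ← Int.cast_natCast, this]
      congr 1
      push_cast
      ring
    have hs := (summable_jacobiTheta₂_term_iff 0 τ).2 hτ
    have hsum : HasSum (fun n : ℤ => jacobiTheta₂_term n 0 τ) (jacobiTheta τ) := by
      rw [jacobiTheta_eq_jacobiTheta₂]
      exact hs.hasSum
    have hprod := summable_mul_of_summable_norm hs.norm h2
    have hprodn := (Summable.mul_norm hs.norm h2)
    have key : ∀ q : ℤ × V d, jacobiTheta₂_term q.1 0 τ * cexp (Real.pi * I * normSqNat q.2 * τ) =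
        cexp (Real.pi * I * normSqNat (Fin.consEquiv (fun _ : Fin (d + 1) => ℤ) q) * τ) := by
      rintro ⟨n, v⟩
      rw [show Fin.consEquiv (fun _ : Fin (d + 1) => ℤ) (n, v) = Fin.cons n v from rfl,
        normSqNat_cons, e, ← Complex.exp_add]
      congr 1
      push_cast
      ring
    constructor
    · rw [← (Fin.consEquiv fun _ : Fin (d + 1) => ℤ).hasSum_iff, pow_succ']
      have h := hsum.mul h1 hprod
      simp only [key] at h
      exact h
    · rw [← (Fin.consEquiv fun _ : Fin (d + 1) => ℤ).summable_iff]
      convert hprodn using 1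
      exact funext fun q => by rw [key q]; rfl

open Complex MeasureTheory in
theorem integral_cexp_pi_mul_I (k : ℤ) :
    ∫ x in Set.Ioc (0 : ℝ) 2, cexp (Real.pi * I * k * x) = if k = 0 then 2 else 0 := by
  rw [← intervalIntegral.integral_of_le (by norm_num)]
  split_ifs with h
  · simp [h]
  · have hc : (Real.pi * I * k : ℂ) ≠ 0 := by simp [h]
    rw [integral_exp_mul_complex hc]
    have : cexp (Real.pi * I * k * (2 : ℝ)) = 1 := by
      rw [Complex.exp_eq_one_iff]
      exact ⟨k, by push_cast; ring⟩
    rw [this]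
    simp

open Complex in
/-- The exponential sum `∑ n ∈ E, exp (-π i n x)`. -/
def expSum (E : Finset ℕ) (x : ℝ) : ℂ := ∑ n ∈ E, cexp (-(Real.pi * I * n * x))

open Complex in
theorem norm_expSum_le (E : Finset ℕ) (x : ℝ) : ‖expSum E x‖ ≤ E.card := by
  refine (norm_sum_le _ _).trans (le_of_eq ?_)
  rw [Finset.card_eq_sum_ones, Nat.cast_sum]
  refine Finset.sum_congr rfl fun n _ => ?_
  rw [show -(Real.pi * I * n * x : ℂ) = ((-(Real.pi * n * x) : ℝ) : ℂ) * I by push_cast; ring,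
    norm_exp_ofReal_mul_I, Nat.cast_one]

theorem continuous_expSum (E : Finset ℕ) : Continuous (expSum E) := by
  unfold expSum
  fun_prop

open Complex MeasureTheory in
theorem integral_cexp_mul_expSum (E : Finset ℕ) (m : ℕ) :
    ∫ x in Set.Ioc (0 : ℝ) 2, cexp (Real.pi * I * m * x) * expSum E x = if m ∈ E then 2 else 0 := by
  simp only [expSum, Finset.mul_sum]
  rw [integral_finsetSum _ fun n _ => ?_]
  · have : ∀ n ∈ E, ∫ x in Set.Ioc (0 : ℝ) 2,
        cexp (Real.pi * I * m * x) * cexp (-(Real.pi * I * n * x)) = if m = n then 2 else 0 := by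
      intro n _
      have h := integral_cexp_pi_mul_I (m - n)
      simp only [sub_eq_zero, Nat.cast_inj] at h
      rw [← h]
      congr 1
      ext x
      rw [← Complex.exp_add]
      push_cast
      ring_nf
    rw [Finset.sum_congr rfl this, Finset.sum_ite_eq]
  · refine Continuous.integrableOn_Ioc ?_
    fun_prop

open Complex MeasureTheory in
theorem lintegral_enorm_expSum_sq (E : Finset ℕ) :
    ∫⁻ x in Set.Ioc (0 : ℝ) 2, ‖expSum E x‖ₑ ^ 2 = ENNReal.ofReal (2 * E.card) := by
  have h1 : ∫ x in Set.Ioc (0 : ℝ) 2, ((‖expSum E x‖ ^ 2 : ℝ) : ℂ) = 2 * E.card := by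
    have : ∀ x, ((‖expSum E x‖ ^ 2 : ℝ) : ℂ) =
        ∑ m ∈ E, cexp (Real.pi * I * m * x) * expSum E x := by
      intro x
      rw [ofReal_pow, ← conj_mul', ← Finset.sum_mul]
      congr 1
      rw [expSum, map_sum]
      refine Finset.sum_congr rfl fun m _ => ?_
      rw [← exp_conj]
      simp
    simp only [this]
    rw [integral_finsetSum _ fun n _ => ?_]
    · rw [Finset.sum_congr rfl fun m _ => integral_cexp_mul_expSum E m,
        Finset.sum_congr rfl fun m hm => if_pos hm]
      simp [mul_comm]
    · refine Continuous.integrableOn_Ioc ?_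
      have := continuous_expSum E
      fun_prop
  rw [integral_complex_ofReal] at h1
  have h2 : ∫ x in Set.Ioc (0 : ℝ) 2, ‖expSum E x‖ ^ 2 = 2 * E.card := by exact_mod_cast h1
  rw [← h2, ofReal_integral_eq_lintegral_ofReal]
  · simp [ENNReal.ofReal_pow]
  · refine Continuous.integrableOn_Ioc ?_
    have := continuous_expSum E
    fun_prop
  · exact .of_forall fun x => by positivity

open Complex MeasureTheory in
theorem card_mul_le_lintegral {d : ℕ} {y : ℝ} (hy : 0 < y) (E : Finset ℕ) (W : Finset (V d))
    (hE : ∀ v ∈ W, normSqNat v ∈ E) (hW : ∀ v ∈ W, normSqNat v * y ≤ 1) :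
    ENNReal.ofReal (Real.exp (-Real.pi) * W.card) ≤
      ∫⁻ x in Set.Ioc (0 : ℝ) 2,
        ENNReal.ofReal (‖jacobiTheta (x + y * I)‖ ^ d) * ‖expSum E x‖ₑ := by
  classical
  have him : ∀ x : ℝ, ((x : ℂ) + y * I).im = y := fun x => by simp
  let F : V d → ℝ → ℂ := fun v x => cexp (Real.pi * I * normSqNat v * (x + y * I)) * expSum E x
  have hc := continuous_expSum E
  have hFc : ∀ v, Continuous (F v) := fun v => by fun_prop
  have hF : ∀ v x, ‖F v x‖ ≤ Real.exp (-Real.pi * normSqNat v * y) * E.card := by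
    intro v x
    rw [norm_mul, norm_cexp_pi_mul_I, him]
    gcongr
    exact norm_expSum_le E x
  have hs0 := (hasSum_jacobiTheta_pow d (τ := y * I) (by simpa using hy)).2
  simp only [norm_cexp_pi_mul_I] at hs0
  have hs : Summable fun v => ∫ x in Set.Ioc (0 : ℝ) 2, ‖F v x‖ := by
    refine Summable.of_nonneg_of_le (fun v => integral_nonneg fun x => norm_nonneg _) (fun v => ?_)
      ((hs0.mul_right (E.card : ℝ)).mul_left 2)
    have h : ∫ x in Set.Ioc (0 : ℝ) 2, ‖F v x‖ ≤
        ∫ x in Set.Ioc (0 : ℝ) 2, Real.exp (-Real.pi * normSqNat v * y) * E.card :=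
      integral_mono ((hFc v).norm.integrableOn_Ioc) (integrable_const _) fun x => hF v x
    simpa using h
  have hsum := hasSum_integral_of_summable_integral_norm
    (fun v => ((hFc v).integrableOn_Ioc : Integrable (F v) (volume.restrict (Set.Ioc (0 : ℝ) 2)))) hs
  have hFint : ∀ v, ∫ x in Set.Ioc (0 : ℝ) 2, F v x =
      ((if normSqNat v ∈ E then 2 * Real.exp (-Real.pi * normSqNat v * y) else 0 : ℝ) : ℂ) := by
    intro v
    have : ∀ x : ℝ, F v x = (Real.exp (-Real.pi * normSqNat v * y) : ℂ) *
        (cexp (Real.pi * I * normSqNat v * x) * expSum E x) := by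
      intro x
      simp only [F]
      rw [← mul_assoc, ofReal_exp, ← Complex.exp_add]
      congr 2
      push_cast
      linear_combination (Real.pi * normSqNat v * y : ℂ) * I_mul_I
    simp only [this]
    rw [integral_const_mul, integral_cexp_mul_expSum]
    split_ifs <;> push_cast <;> ring
  have hF' : ∀ x, ∑' v, F v x = jacobiTheta (x + y * I) ^ d * expSum E x := by
    intro x
    exact ((hasSum_jacobiTheta_pow d (τ := x + y * I) (by simpa using hy)).1.mul_right _).tsum_eq
  simp only [hFint, hF'] at hsum
  set Z := ∫ x in Set.Ioc (0 : ℝ) 2, jacobiTheta (x + y * I) ^ d * expSum E x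
  have hre := Complex.hasSum_re hsum
  simp only [ofReal_re] at hre
  have h1 : Real.exp (-Real.pi) * W.card ≤ ‖Z‖ := by
    refine le_trans ?_ (re_le_norm Z)
    refine le_trans ?_ (sum_le_hasSum W (fun v _ => by positivity) hre)
    rw [mul_comm, ← nsmul_eq_mul]
    refine Finset.card_nsmul_le_sum _ _ _ fun v hv => ?_
    rw [if_pos (hE v hv)]
    have : Real.exp (-Real.pi) ≤ Real.exp (-Real.pi * normSqNat v * y) := by
      apply Real.exp_le_exp.2
      nlinarith [hW v hv, Real.pi_pos]
    linarith [Real.exp_pos (-Real.pi)]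
  calc _ ≤ ENNReal.ofReal ‖Z‖ := ENNReal.ofReal_le_ofReal h1
    _ = ‖Z‖ₑ := ofReal_norm Z
    _ ≤ _ := enorm_integral_le_lintegral_enorm _
    _ = _ := by simp [enorm_mul, enorm_pow, ENNReal.ofReal_pow]

theorem finite_normSqNat_eq (d n : ℕ) : {v : V d | normSqNat v = n}.Finite := by
  refine (Set.Finite.pi fun _ : Fin d => Set.finite_Icc (-(n : ℤ)) n).subset fun v hv => ?_
  have hv : normSqNat v = n := hv
  simp only [Set.mem_pi, Set.mem_univ, Set.mem_Icc, forall_true_left]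
  intro i
  have h1 : (v i).natAbs ^ 2 ≤ n := by
    rw [← hv]
    exact Finset.single_le_sum (f := fun i => (v i).natAbs ^ 2) (fun _ _ => Nat.zero_le _)
      (Finset.mem_univ i)
  have h2 : (v i).natAbs ≤ (v i).natAbs ^ 2 := Nat.le_self_pow (by norm_num) _
  omega

/-- The lattice points of squared length `n`. -/
def shell (d n : ℕ) : Finset (V d) := (finite_normSqNat_eq d n).toFinset

@[simp]
theorem mem_shell {d n : ℕ} {v : V d} : v ∈ shell d n ↔ normSqNat v = n := by
  simp [shell]

theorem card_shell_succ_le {d n m : ℕ} (h : n ≤ m) : (shell (d + 1) n).card ≤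
    ∑ a ∈ Finset.Icc (-(m.sqrt : ℤ)) m.sqrt,
      if a.natAbs ^ 2 ≤ n then (shell d (n - a.natAbs ^ 2)).card else 0 := by
  classical
  rw [← Finset.sum_filter, ← Finset.card_sigma]
  refine Finset.card_le_card_of_injOn (fun v => ⟨v 0, Fin.tail v⟩) ?_ ?_
  · intro v hv
    have hv : normSqNat v = n := by simpa using hv
    rw [← Fin.cons_self_tail v, normSqNat_cons] at hv
    have h1 : (v 0).natAbs ≤ m.sqrt := by
      rw [Nat.le_sqrt']; omega
    simp only [Finset.coe_sigma, Set.mem_sigma_iff, Finset.mem_coe, Finset.mem_filter,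
      Finset.mem_Icc, mem_shell]
    refine ⟨⟨⟨?_, ?_⟩, ?_⟩, ?_⟩ <;> omega
  · intro v _ w _ hvw
    simp only [Sigma.mk.injEq, heq_eq_eq] at hvw
    rw [← Fin.cons_self_tail v, ← Fin.cons_self_tail w, hvw.1, hvw.2]

open Complex in
theorem continuous_norm_jacobiTheta {y : ℝ} (hy : 0 < y) :
    Continuous fun x : ℝ => ‖jacobiTheta (x + y * I)‖ := by
  refine (continuous_iff_continuousAt.2 fun x => ?_).norm
  exact (continuousAt_jacobiTheta (τ := x + y * I) (by simpa using hy)).comp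
    (f := fun x : ℝ => (x + y * I : ℂ)) (by fun_prop)

open Complex MeasureTheory in
theorem exists_card_shell_le {d : ℕ} (hd : 5 ≤ d) : ∃ C : ℝ, 0 < C ∧ ∀ n : ℕ,
    ((shell d n).card : ℝ) ≤ C * √(n + 1) ^ (d - 2) := by
  obtain ⟨j, rfl⟩ : ∃ j, d = j + 5 := ⟨d - 5, by omega⟩
  obtain ⟨K, hK, hKle⟩ := exists_norm_jacobiTheta_pow_four_le
  obtain ⟨C, hC, hCle⟩ := exists_volume_lt_norm_jacobiTheta_le
  set κ := √√K with hκ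
  have hκ0 : 0 < κ := by positivity
  have hκ4 : κ ^ 4 = K := by
    rw [hκ, show 4 = 2 * 2 by norm_num, pow_mul, Real.sq_sqrt (by positivity), Real.sq_sqrt hK.le]
  refine ⟨Real.exp Real.pi * (5 * C * κ ^ (j + 1)), by positivity, fun n => ?_⟩
  set S := √((n : ℝ) + 1) with hS
  have hS2 : S ^ 2 = n + 1 := Real.sq_sqrt (by positivity)
  have hS0 : 0 < S := by positivity
  set y : ℝ := 1 / (n + 1) with hy
  have hy0 : 0 < y := by positivity
  have hy1 : y ≤ 1 := by
    rw [hy, div_le_one (by positivity)]; linarith [(Nat.cast_nonneg n : (0 : ℝ) ≤ n)]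
  have hyS : 1 / y = S ^ 2 := by rw [hS2, hy]; simp
  set T := κ * S with hT
  have hGT : ∀ x : ℝ, ‖jacobiTheta (x + y * I)‖ ≤ T := by
    intro x
    refine le_of_pow_le_pow_left₀ (n := 4) (by norm_num) (by positivity) ?_
    refine (hKle x y hy0 hy1).trans (le_of_eq ?_)
    have : K / y ^ 2 = K * (1 / y) ^ 2 := by ring
    rw [this, hyS, hT, mul_pow, hκ4]
    ring
  have h5 := lintegral_pow_five_le (volume.restrict (Set.Ioc (0 : ℝ) 2))
    (f := fun x => ‖jacobiTheta (x + y * I)‖) (fun x => norm_nonneg _)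
    (continuous_norm_jacobiTheta hy0).aemeasurable (A := C * S ^ 2) (T := T) (by positivity)
    hGT fun t ht => by
      rw [Measure.restrict_apply' measurableSet_Ioc, Set.inter_comm]
      refine (hCle y t hy0 hy1 ht).trans (le_of_eq ?_)
      rw [← hyS]
      congr 1
      field_simp
  have hcard := card_mul_le_lintegral (d := j + 5) hy0 {n} (shell (j + 5) n) (by simp) fun v hv => by
    rw [mem_shell.1 hv, hy, mul_one_div, div_le_one (by positivity)]
    linarith
  have hle : ∫⁻ x in Set.Ioc (0 : ℝ) 2,
        ENNReal.ofReal (‖jacobiTheta (x + y * I)‖ ^ (j + 5)) * ‖expSum {n} x‖ₑ ≤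
      ENNReal.ofReal (T ^ j) * ENNReal.ofReal (5 * (C * S ^ 2) * T) := by
    refine le_trans ?_ (mul_le_mul_right h5 _)
    rw [← lintegral_const_mul' _ _ ENNReal.ofReal_ne_top]
    refine lintegral_mono fun x => ?_
    have h1 : ‖expSum {n} x‖ₑ ≤ 1 := by
      rw [← ofReal_norm, ENNReal.ofReal_le_one]
      simpa using norm_expSum_le {n} x
    refine (mul_le_mul_right h1 _).trans ?_
    rw [mul_one, ← ENNReal.ofReal_mul (by positivity), pow_add]
    apply ENNReal.ofReal_le_ofReal
    gcongr
    exact hGT x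
  have hfin := hcard.trans hle
  rw [← ENNReal.ofReal_mul (by positivity), ENNReal.ofReal_le_ofReal_iff (by positivity)] at hfin
  rw [show j + 5 - 2 = j + 3 by omega]
  calc ((shell (j + 5) n).card : ℝ)
      = Real.exp Real.pi * (Real.exp (-Real.pi) * (shell (j + 5) n).card) := by
        rw [← mul_assoc, ← Real.exp_add]; simp
    _ ≤ Real.exp Real.pi * (T ^ j * (5 * (C * S ^ 2) * T)) := by gcongr
    _ = _ := by rw [hT]; ring

open Complex MeasureTheory in
theorem exists_card_lt_card_shell_three_le : ∃ C : ℝ, 0 < C ∧ ∀ (m : ℕ) (s : ℝ), 0 < s →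
    (((Finset.range (m + 1)).filter fun n => s < (shell 3 n).card).card : ℝ) ≤
      C * (m + 1) ^ 3 / s ^ 4 := by
  classical
  obtain ⟨C, hC, hCle⟩ := exists_volume_lt_norm_jacobiTheta_le
  refine ⟨(Real.exp Real.pi * 9) ^ 4 * C ^ 3, by positivity, fun m s hs => ?_⟩
  set E := (Finset.range (m + 1)).filter fun n => s < (shell 3 n).card with hE
  rcases E.eq_empty_or_nonempty with h0 | hne
  · rw [h0]; simp; positivity
  set N := (E.card : ℝ) with hN
  have hN0 : 0 < N := by rw [hN]; exact_mod_cast hne.card_pos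
  set L := (m : ℝ) + 1 with hL
  have hL0 : 0 < L := by positivity
  set y : ℝ := 1 / L with hy
  have hy0 : 0 < y := by positivity
  have hy1 : y ≤ 1 := by
    rw [hy, div_le_one (by positivity)]; linarith [(Nat.cast_nonneg m : (0 : ℝ) ≤ m)]
  let W := E.biUnion (shell 3)
  have hWcard : s * N ≤ W.card := by
    have h1 : W.card = ∑ n ∈ E, (shell 3 n).card := by
      refine Finset.card_biUnion fun a _ b _ hab => ?_
      refine Finset.disjoint_left.2 fun v hv hv' => hab ?_
      rw [← mem_shell.1 hv, ← mem_shell.1 hv']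
    rw [h1, hN, mul_comm, ← nsmul_eq_mul]
    push_cast
    exact Finset.card_nsmul_le_sum _ _ _ fun n hn => (Finset.mem_filter.1 hn).2.le
  have hcard := card_mul_le_lintegral (d := 3) hy0 E W
    (fun v hv => by
      obtain ⟨n, hn, hv⟩ := Finset.mem_biUnion.1 hv
      rwa [mem_shell.1 hv])
    (fun v hv => by
      obtain ⟨n, hn, hv⟩ := Finset.mem_biUnion.1 hv
      rw [mem_shell.1 hv, hy, mul_one_div, div_le_one hL0, hL]
      have := Finset.mem_range.1 (Finset.mem_filter.1 hn).1
      exact_mod_cast this.le)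
  set G : ℝ → ℝ := fun x => ‖jacobiTheta (x + y * I)‖ with hG
  have hGc : Continuous G := continuous_norm_jacobiTheta hy0
  have hDc := continuous_expSum E
  have hDm : Measurable fun x => ‖expSum E x‖ₑ := hDc.enorm.measurable
  have hvol : ∀ t, 0 < t → volume ({x | t < G x} ∩ Set.Ioc 0 2) ≤ ENNReal.ofReal (C * L / t ^ 4) := by
    intro t ht
    rw [Set.inter_comm]
    refine (hCle y t hy0 hy1 ht).trans (le_of_eq ?_)
    congr 1
    rw [hy]
    field_simp
  have hmeas : ∀ t, MeasurableSet {x | t < G x} := fun t =>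
    measurableSet_lt measurable_const hGc.measurable
  set μ := volume.restrict (Set.Ioc (0 : ℝ) 2) with hμ
  set ν := μ.withDensity fun x => ‖expSum E x‖ₑ with hν
  set B := C * N * L with hB
  have hB0 : 0 < B := by positivity
  set β := √√B with hβ
  have hβ0 : 0 < β := by positivity
  have hβ2 : β ^ 2 = √B := Real.sq_sqrt (by positivity)
  have hβ4 : β ^ 4 = B := by
    rw [show 4 = 2 * 2 by norm_num, pow_mul, hβ2, Real.sq_sqrt hB0.le]
  have h3 := lintegral_pow_three_le ν (f := G) (fun x => norm_nonneg _) hGc.aemeasurable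
    (A := 2 * β ^ 2) (B := B) (H := β) (by positivity) hB0.le hβ0
    (fun t ht _ => by
      rw [hν, withDensity_apply _ (hmeas t)]
      have hCS := ENNReal.lintegral_mul_le_Lp_mul_Lq (μ.restrict {x | t < G x})
        Real.HolderConjugate.two_two hDm.aemeasurable (aemeasurable_const (b := (1 : ENNReal)))
      simp only [Pi.mul_apply, mul_one, ENNReal.one_rpow, lintegral_const, one_mul,
        Measure.restrict_apply_univ] at hCS
      refine hCS.trans ?_
      have hb1 : ∫⁻ x in {x | t < G x}, ‖expSum E x‖ₑ ^ (2 : ℝ) ∂μ ≤ ENNReal.ofReal (2 * N) := by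
        rw [hN, ← lintegral_enorm_expSum_sq]
        refine (setLIntegral_le_lintegral _ _).trans (le_of_eq ?_)
        simp [hμ]
      have hb2 : μ {x | t < G x} ≤ ENNReal.ofReal (C * L / t ^ 4) := by
        rw [hμ, Measure.restrict_apply (hmeas t)]
        exact hvol t ht
      calc _ ≤ ENNReal.ofReal (2 * N) ^ (1 / 2 : ℝ) * ENNReal.ofReal (C * L / t ^ 4) ^ (1 / 2 : ℝ) := by
            gcongr
        _ ≤ _ := by
            rw [ENNReal.ofReal_rpow_of_nonneg (by positivity) (by norm_num),
              ENNReal.ofReal_rpow_of_nonneg (by positivity) (by norm_num),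
              ← ENNReal.ofReal_mul (by positivity)]
            apply ENNReal.ofReal_le_ofReal
            rw [← Real.sqrt_eq_rpow, ← Real.sqrt_eq_rpow, ← Real.sqrt_mul (by positivity)]
            refine Real.sqrt_le_iff.2 ⟨by positivity, ?_⟩
            rw [div_pow, mul_pow, ← pow_mul, hβ4, hB]
            field_simp
            norm_num)
    (fun t ht => by
      have ht0 : 0 < t := hβ0.trans ht
      rw [hν, withDensity_apply _ (hmeas t)]
      calc _ ≤ ∫⁻ x in {x | t < G x}, ENNReal.ofReal N ∂μ := by
            refine lintegral_mono fun x => ?_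
            rw [← ofReal_norm]
            exact ENNReal.ofReal_le_ofReal (norm_expSum_le E x)
        _ ≤ ENNReal.ofReal N * ENNReal.ofReal (C * L / t ^ 4) := by
            rw [setLIntegral_const, hμ, Measure.restrict_apply (hmeas t)]
            gcongr
            exact hvol t ht0
        _ = _ := by
            rw [← ENNReal.ofReal_mul hN0.le, hB]
            ring_nf)
  rw [hν, lintegral_withDensity_eq_lintegral_mul _ hDm
    (by have := hGc.measurable; fun_prop)] at h3
  have hfin := hcard.trans (le_trans (le_of_eq ?_) h3)
  · rw [ENNReal.ofReal_le_ofReal_iff (by positivity)] at hfin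
    have e1 : 3 * (2 * β ^ 2 * β + B / β) = 9 * β ^ 3 := by
      rw [← hβ4]; field_simp; ring
    rw [e1] at hfin
    have h1 : s * N ≤ Real.exp Real.pi * 9 * β ^ 3 := by
      calc s * N ≤ W.card := hWcard
        _ = Real.exp Real.pi * (Real.exp (-Real.pi) * W.card) := by
          rw [← mul_assoc, ← Real.exp_add]; simp
        _ ≤ Real.exp Real.pi * (9 * β ^ 3) := by gcongr
        _ = _ := by ring
    have h2 : (s * N) ^ 4 ≤ (Real.exp Real.pi * 9 * β ^ 3) ^ 4 := by gcongr
    have h4 : (Real.exp Real.pi * 9 * β ^ 3) ^ 4 = (Real.exp Real.pi * 9) ^ 4 * C ^ 3 * L ^ 3 * N ^ 3 := by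
      rw [mul_pow _ (β ^ 3), ← pow_mul, show 3 * 4 = 4 * 3 by norm_num, pow_mul β, hβ4, hB]
      ring
    rw [h4, mul_pow] at h2
    rw [le_div_iff₀ (by positivity)]
    have h5 : (N * s ^ 4) * N ^ 3 ≤ ((Real.exp Real.pi * 9) ^ 4 * C ^ 3 * L ^ 3) * N ^ 3 := by
      linarith
    exact le_of_mul_le_mul_right h5 (by positivity)
  · refine lintegral_congr fun x => ?_
    rw [Pi.mul_apply, mul_comm]

open MeasureTheory in
theorem exists_sum_card_shell_three_pow_le : ∃ C : ℝ, 0 < C ∧ ∀ m : ℕ,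
    ∑ n ∈ Finset.range (m + 1), ((shell 3 n).card : ℝ) ^ 3 ≤ C * √(m + 1) ^ 5 := by
  obtain ⟨C, hC, hle⟩ := exists_card_lt_card_shell_three_le
  refine ⟨3 * (1 + C), by positivity, fun m => ?_⟩
  set S := √((m : ℝ) + 1) with hS
  have hS2 : S ^ 2 = m + 1 := Real.sq_sqrt (by positivity)
  have hS0 : 0 < S := by positivity
  let f : Fin (m + 1) → ℝ := fun n => (shell 3 n).card
  have hcount : ∀ t : ℝ, Measure.count {n | t < f n} =
      ENNReal.ofReal ((Finset.range (m + 1)).filter fun n => t < (shell 3 n).card).card := by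
    intro t
    rw [Measure.count_apply_finite _ (Set.toFinite _), ENNReal.ofReal_natCast]
    refine congrArg Nat.cast ?_
    refine Finset.card_bij (fun n _ => (n : ℕ)) ?_ (fun a _ b _ h => Fin.ext h) ?_
    · intro a ha
      have ha' := (Set.Finite.mem_toFinset _).1 ha
      simp only [Finset.mem_filter, Finset.mem_range]
      exact ⟨a.2, ha'⟩
    · intro b hb
      simp only [Finset.mem_filter, Finset.mem_range] at hb
      exact ⟨⟨b, hb.1⟩, (Set.Finite.mem_toFinset _).2 hb.2, rfl⟩
  have h := lintegral_pow_three_le Measure.count (f := f) (fun x => Nat.cast_nonneg _)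
    (measurable_of_finite f).aemeasurable (A := S ^ 4) (B := C * S ^ 6) (H := S) (by positivity)
    (by positivity) hS0
    (fun t ht htS => by
      rw [hcount]
      apply ENNReal.ofReal_le_ofReal
      rw [le_div_iff₀ (by positivity)]
      have h1 : (((Finset.range (m + 1)).filter fun n => t < (shell 3 n).card).card : ℝ) ≤ S ^ 2 := by
        rw [hS2]
        exact_mod_cast (Finset.card_filter_le _ _).trans (by simp)
      calc _ ≤ S ^ 2 * S ^ 2 := by gcongr
        _ = _ := by ring)
    (fun t ht => by
      rw [hcount]
      apply ENNReal.ofReal_le_ofReal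
      refine (hle m t (hS0.trans ht)).trans (le_of_eq ?_)
      rw [← hS2]
      ring)
  rw [lintegral_count, tsum_fintype, ← ENNReal.ofReal_sum_of_nonneg fun _ _ => by positivity,
    ENNReal.ofReal_le_ofReal_iff (by positivity)] at h
  rw [← Fin.sum_univ_eq_sum_range (fun n => ((shell 3 n).card : ℝ) ^ 3)]
  refine h.trans (le_of_eq ?_)
  field_simp

theorem sum_card_shell_succ_pow_three_le {d k : ℕ} {C : ℝ} (hC : 0 ≤ C)
    (hle : ∀ m : ℕ, ∑ n ∈ Finset.range (m + 1), ((shell d n).card : ℝ) ^ 3 ≤ C * √(m + 1) ^ k)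
    (m : ℕ) : ∑ n ∈ Finset.range (m + 1), ((shell (d + 1) n).card : ℝ) ^ 3 ≤
      27 * C * √(m + 1) ^ (k + 3) := by
  set S := √((m : ℝ) + 1) with hS
  have hS2 : S ^ 2 = m + 1 := Real.sq_sqrt (by positivity)
  have hS1 : 1 ≤ S := by
    rw [hS, Real.one_le_sqrt]; linarith [(Nat.cast_nonneg m : (0 : ℝ) ≤ m)]
  set J := Finset.Icc (-(m.sqrt : ℤ)) m.sqrt
  have hJ : (J.card : ℝ) ≤ 3 * S := by
    have h1 : J.card = 2 * m.sqrt + 1 := by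
      simp only [J, Int.card_Icc]
      omega
    have h2 : (m.sqrt : ℝ) ≤ S := by
      apply Real.le_sqrt_of_sq_le
      have : (m.sqrt : ℝ) ^ 2 ≤ m := by exact_mod_cast Nat.sqrt_le' m
      linarith
    rw [h1]
    push_cast
    linarith
  obtain ⟨g, hg⟩ : ∃ g : ℤ → ℕ → ℝ, ∀ a n, g a n =
      if a.natAbs ^ 2 ≤ n then ((shell d (n - a.natAbs ^ 2)).card : ℝ) else 0 := ⟨_, fun _ _ => rfl⟩
  have hg0 : ∀ a n, 0 ≤ g a n := by
    intro a n
    rw [hg]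
    split_ifs <;> positivity
  have h1 : ∀ n ∈ Finset.range (m + 1), ((shell (d + 1) n).card : ℝ) ^ 3 ≤ 9 * S ^ 2 * ∑ a ∈ J, g a n ^ 3 := by
    intro n hn
    have h2 : ((shell (d + 1) n).card : ℝ) ≤ ∑ a ∈ J, g a n := by
      have := card_shell_succ_le (d := d) (n := n) (m := m) (by
        have := Finset.mem_range.1 hn
        omega)
      have this' : ((shell (d + 1) n).card : ℝ) ≤ ((∑ a ∈ Finset.Icc (-(m.sqrt : ℤ)) m.sqrt,
          if a.natAbs ^ 2 ≤ n then (shell d (n - a.natAbs ^ 2)).card else 0 : ℕ) : ℝ) :=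
        Nat.cast_le.2 this
      rw [Nat.cast_sum] at this'
      refine this'.trans (le_of_eq (Finset.sum_congr rfl fun a _ => ?_))
      rw [hg, Nat.cast_ite, Nat.cast_zero]
    calc ((shell (d + 1) n).card : ℝ) ^ 3 ≤ (∑ a ∈ J, g a n) ^ 3 := pow_le_pow_left₀ (Nat.cast_nonneg _) h2 3
      _ ≤ (J.card : ℝ) ^ 2 * ∑ a ∈ J, g a n ^ 3 :=
        pow_sum_le_card_mul_sum_pow (fun a _ => hg0 a n) 2
      _ ≤ (3 * S) ^ 2 * ∑ a ∈ J, g a n ^ 3 := by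
        refine mul_le_mul_of_nonneg_right (pow_le_pow_left₀ (Nat.cast_nonneg _) hJ 2) ?_
        exact Finset.sum_nonneg fun a _ => pow_nonneg (hg0 a n) 3
      _ = _ := by ring
  have h3 : ∀ a ∈ J, ∑ n ∈ Finset.range (m + 1), g a n ^ 3 ≤ C * S ^ k := by
    intro a _
    refine le_trans ?_ (hle m)
    have e : ∀ n, g a n ^ 3 =
        if a.natAbs ^ 2 ≤ n then ((shell d (n - a.natAbs ^ 2)).card : ℝ) ^ 3 else 0 := by
      intro n
      simp only [hg]
      split_ifs <;> simp
    simp only [e]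
    rw [← Finset.sum_filter]
    refine le_trans (le_of_eq ?_) (Finset.sum_le_sum_of_subset_of_nonneg
      (s := ((Finset.range (m + 1)).filter fun n => a.natAbs ^ 2 ≤ n).image fun n => n - a.natAbs ^ 2)
      ?_ fun _ _ _ => by positivity)
    · rw [Finset.sum_image]
      intro x hx y hy hxy
      simp only [Finset.coe_filter, Set.mem_ofPred_eq] at hx hy hxy
      omega
    · intro x hx
      simp only [Finset.mem_image, Finset.mem_filter, Finset.mem_range] at hx ⊢
      obtain ⟨n, hn, rfl⟩ := hx
      omega
  calc _ ≤ ∑ n ∈ Finset.range (m + 1), 9 * S ^ 2 * ∑ a ∈ J, g a n ^ 3 := Finset.sum_le_sum h1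
    _ = 9 * S ^ 2 * ∑ a ∈ J, ∑ n ∈ Finset.range (m + 1), g a n ^ 3 := by
      rw [← Finset.mul_sum, Finset.sum_comm]
    _ ≤ 9 * S ^ 2 * (J.card * (C * S ^ k)) := by
      rw [← nsmul_eq_mul]
      gcongr
      exact Finset.sum_le_card_nsmul _ _ _ h3
    _ ≤ 9 * S ^ 2 * (3 * S * (C * S ^ k)) := by gcongr
    _ = _ := by ring

theorem exists_sum_card_shell_four_pow_le : ∃ C : ℝ, 0 < C ∧ ∀ m : ℕ,
    ∑ n ∈ Finset.range (m + 1), ((shell 4 n).card : ℝ) ^ 3 ≤ C * √(m + 1) ^ 8 := by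
  obtain ⟨C, hC, hle⟩ := exists_sum_card_shell_three_pow_le
  exact ⟨27 * C, by positivity, sum_card_shell_succ_pow_three_le hC.le hle⟩

theorem exists_sum_card_shell_mul_sq_le {d : ℕ} (hd : d = 3 ∨ d = 4) : ∃ C : ℝ, 0 < C ∧ ∀ m : ℕ,
    ∑ n ∈ Finset.range (m + 1), ((shell d n).card : ℝ) * ((shell d (m - n)).card : ℝ) ^ 2 ≤
      C * √(m + 1) ^ (3 * d - 4) := by
  obtain ⟨C, hC, hle⟩ : ∃ C : ℝ, 0 < C ∧ ∀ m : ℕ,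
      ∑ n ∈ Finset.range (m + 1), ((shell d n).card : ℝ) ^ 3 ≤ C * √(m + 1) ^ (3 * d - 4) := by
    rcases hd with rfl | rfl
    · exact exists_sum_card_shell_three_pow_le
    · exact exists_sum_card_shell_four_pow_le
  refine ⟨2 * C, by positivity, fun m => ?_⟩
  have h : ∑ n ∈ Finset.range (m + 1), ((shell d (m - n)).card : ℝ) ^ 3 =
      ∑ n ∈ Finset.range (m + 1), ((shell d n).card : ℝ) ^ 3 := by
    rw [← Finset.sum_range_reflect]
    refine Finset.sum_congr rfl fun n hn => ?_
    have := Finset.mem_range.1 hn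
    rw [show m - (m + 1 - 1 - n) = n by omega]
  have key : ∀ a b : ℝ, 0 ≤ a → 0 ≤ b → a * b ^ 2 ≤ a ^ 3 + b ^ 3 := by
    intro a b ha hb
    rcases le_total a b with hab | hab
    · nlinarith [mul_le_mul_of_nonneg_right hab (sq_nonneg b), pow_nonneg ha 3]
    · nlinarith [mul_le_mul_of_nonneg_left (pow_le_pow_left₀ hb hab 2) ha, pow_nonneg hb 3]
  calc _ ≤ ∑ n ∈ Finset.range (m + 1),
        (((shell d n).card : ℝ) ^ 3 + ((shell d (m - n)).card : ℝ) ^ 3) :=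
        Finset.sum_le_sum fun n _ => key _ _ (Nat.cast_nonneg _) (Nat.cast_nonneg _)
    _ ≤ C * √(m + 1) ^ (3 * d - 4) + C * √(m + 1) ^ (3 * d - 4) := by
        rw [Finset.sum_add_distrib, h]
        exact add_le_add (hle m) (hle m)
    _ = _ := by ring

/-- The lattice cube of side length `2 R + 1` centred at the origin. -/
def cube (d R : ℕ) : Finset (V d) := Fintype.piFinset fun _ => Finset.Icc (-(R : ℤ)) R

theorem mem_cube {d R : ℕ} {u : V d} : u ∈ cube d R ↔ ∀ i, -(R : ℤ) ≤ u i ∧ u i ≤ R := by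
  simp [cube]

theorem card_cube (d R : ℕ) : (cube d R).card = (2 * R + 1) ^ d := by
  rw [cube, Fintype.card_piFinset_const, Int.card_Icc]
  congr 1
  omega

/-- The number of `v` with `(u, v)` on the sphere of squared radius `lam`. -/
def fiberCard {d : ℕ} (lam : ℕ) (u : V d) : ℕ :=
  if normSqNat u ≤ lam then (shell d (lam - normSqNat u)).card else 0

theorem mem_sph_iff {d lam : ℕ} {uv : V d × V d} :
    uv ∈ sph d lam ↔ normSqNat uv.1 + normSqNat uv.2 = lam := by
  rw [sph, Set.mem_ofPred_eq, ← natCast_normSqNat, ← natCast_normSqNat]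
  norm_cast

theorem mem_cube_sqrt_of_normSqNat_le {d n : ℕ} {u : V d} (h : normSqNat u ≤ n) :
    u ∈ cube d n.sqrt := by
  refine mem_cube.2 fun i => ?_
  have h1 : (u i).natAbs ^ 2 ≤ n :=
    (Finset.single_le_sum (f := fun i => (u i).natAbs ^ 2) (fun _ _ => Nat.zero_le _)
      (Finset.mem_univ i)).trans h
  have h2 : (u i).natAbs ≤ n.sqrt := Nat.le_sqrt'.2 h1
  omega

theorem sum_sph_fst {d lam : ℕ} (h : V d → ℝ) :
    ∑ uv ∈ (sph_finite d lam).toFinset, h uv.1 =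
      ∑ u ∈ cube d lam.sqrt, (fiberCard lam u : ℝ) * h u := by
  rw [← Finset.sum_fiberwise_of_maps_to (t := cube d lam.sqrt) (g := Prod.fst)]
  · refine Finset.sum_congr rfl fun u _ => ?_
    rw [Finset.sum_congr rfl (g := fun _ => h u) fun uv huv => by
      rw [(Finset.mem_filter.1 huv).2], Finset.sum_const, nsmul_eq_mul]
    congr 2
    rw [fiberCard]
    split_ifs with hu
    · refine Finset.card_bij (fun uv _ => uv.2) ?_ ?_ ?_
      · intro uv huv
        rw [Finset.mem_filter, Set.Finite.mem_toFinset, mem_sph_iff] at huv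
        rw [mem_shell, ← huv.2]
        omega
      · intro a ha b hb hab
        exact Prod.ext ((Finset.mem_filter.1 ha).2.trans (Finset.mem_filter.1 hb).2.symm) hab
      · intro v hv
        rw [mem_shell] at hv
        refine ⟨(u, v), ?_, rfl⟩
        rw [Finset.mem_filter, Set.Finite.mem_toFinset, mem_sph_iff]
        exact ⟨by simp only; omega, rfl⟩
    · rw [Finset.card_eq_zero, Finset.filter_eq_empty_iff]
      intro uv huv hu'
      rw [Set.Finite.mem_toFinset, mem_sph_iff, hu'] at huv
      omega
  · intro uv huv
    rw [Set.Finite.mem_toFinset, mem_sph_iff] at huv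
    exact mem_cube_sqrt_of_normSqNat_le (by omega)

theorem sum_sph_snd {d lam : ℕ} (h : V d → ℝ) :
    ∑ uv ∈ (sph_finite d lam).toFinset, h uv.2 =
      ∑ uv ∈ (sph_finite d lam).toFinset, h uv.1 := by
  refine Finset.sum_nbij' Prod.swap Prod.swap ?_ ?_ ?_ ?_ ?_ <;>
    simp +contextual [mem_sph_iff, add_comm]

theorem two_mul_sqrt_add_one_le (lam : ℕ) : (2 * lam.sqrt + 1 : ℝ) ≤ 3 * √(lam + 1) := by
  have h1 : (1 : ℝ) ≤ √((lam : ℝ) + 1) := by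
    rw [Real.one_le_sqrt]; linarith [(Nat.cast_nonneg lam : (0 : ℝ) ≤ lam)]
  have h2 : (lam.sqrt : ℝ) ≤ √((lam : ℝ) + 1) := by
    apply Real.le_sqrt_of_sq_le
    have : (lam.sqrt : ℝ) ^ 2 ≤ lam := by exact_mod_cast Nat.sqrt_le' lam
    linarith
  linarith

theorem sum_fiberCard_sq_le (d lam : ℕ) :
    ∑ u ∈ cube d lam.sqrt, (fiberCard lam u : ℝ) ^ 2 ≤
      ∑ n ∈ Finset.range (lam + 1), ((shell d n).card : ℝ) * ((shell d (lam - n)).card : ℝ) ^ 2 := by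
  have h1 : ∑ u ∈ cube d lam.sqrt, (fiberCard lam u : ℝ) ^ 2 =
      ∑ u ∈ (cube d lam.sqrt).filter (fun u => normSqNat u ≤ lam),
        ((shell d (lam - normSqNat u)).card : ℝ) ^ 2 := by
    rw [Finset.sum_filter]
    refine Finset.sum_congr rfl fun u _ => ?_
    rw [fiberCard]
    split_ifs <;> simp
  rw [h1, ← Finset.sum_fiberwise_of_maps_to (t := Finset.range (lam + 1)) (g := normSqNat)]
  · refine Finset.sum_le_sum fun n _ => ?_
    rw [Finset.sum_congr rfl (g := fun _ => ((shell d (lam - n)).card : ℝ) ^ 2) fun u hu => by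
      rw [(Finset.mem_filter.1 hu).2], Finset.sum_const, nsmul_eq_mul]
    gcongr
    intro u hu
    rw [mem_shell]
    exact (Finset.mem_filter.1 hu).2
  · intro u hu
    rw [Finset.mem_range]
    have := (Finset.mem_filter.1 hu).2
    omega

theorem sqrt_succ_pow_two_mul (lam k : ℕ) : (√((lam : ℝ) + 1)) ^ (2 * k) = (lam + 1 : ℝ) ^ k := by
  rw [pow_mul, Real.sq_sqrt (by positivity)]

theorem exists_sum_fiberCard_mul_le {d : ℕ} (hd : 5 ≤ d) : ∃ C : ℝ, 0 < C ∧ ∀ lam : ℕ,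
    0 < Ncount d lam → ∀ h : V d → ℝ, 0 ≤ h →
      (∑ u ∈ cube d lam.sqrt, (fiberCard lam u : ℝ) * h u) ≤
        C * Ncount d lam * ((∑ u ∈ cube d lam.sqrt, h u) / (2 * lam.sqrt + 1) ^ d) := by
  obtain ⟨c, hc, hN⟩ := exists_le_Ncount (show 3 ≤ d by omega)
  obtain ⟨C, hC, hle⟩ := exists_card_shell_le hd
  refine ⟨C * 3 ^ d / c, by positivity, fun lam hlam h hh => ?_⟩
  have hNl := hN lam hlam
  have hR := two_mul_sqrt_add_one_le lam
  rw [← sqrt_succ_pow_two_mul] at hNl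
  have hK : ∀ u : V d, (fiberCard lam u : ℝ) ≤ C * √((lam : ℝ) + 1) ^ (d - 2) := by
    intro u
    rw [fiberCard]
    split_ifs with hu
    · refine (hle _).trans ?_
      gcongr
      omega
    · simp only [Nat.cast_zero]; positivity
  set S := √((lam : ℝ) + 1)
  have hS : 0 < S := by positivity
  have hs : 0 ≤ ∑ u ∈ cube d lam.sqrt, h u := Finset.sum_nonneg fun u _ => hh u
  calc ∑ u ∈ cube d lam.sqrt, (fiberCard lam u : ℝ) * h u
      ≤ ∑ u ∈ cube d lam.sqrt, (C * S ^ (d - 2)) * h u :=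
        Finset.sum_le_sum fun u _ => mul_le_mul_of_nonneg_right (hK u) (hh u)
    _ = C * S ^ (d - 2) * ∑ u ∈ cube d lam.sqrt, h u := by rw [Finset.mul_sum]
    _ = C * 3 ^ d / c * (c * S ^ (2 * (d - 1))) * ((∑ u ∈ cube d lam.sqrt, h u) / (3 * S) ^ d) := by
        rw [show 2 * (d - 1) = (d - 2) + d by omega, pow_add, mul_pow]
        field_simp
    _ ≤ _ := by gcongr

theorem exists_sum_fiberCard_mul_sq_le {d : ℕ} (hd : d = 3 ∨ d = 4) : ∃ C : ℝ, 0 < C ∧ ∀ lam : ℕ,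
    0 < Ncount d lam → ∀ h : V d → ℝ,
      (∑ u ∈ cube d lam.sqrt, (fiberCard lam u : ℝ) * h u) ^ 2 ≤
        C * (Ncount d lam : ℝ) ^ 2 *
          ((∑ u ∈ cube d lam.sqrt, h u ^ 2) / (2 * lam.sqrt + 1) ^ d) := by
  obtain ⟨c, hc, hN⟩ := exists_le_Ncount (show 3 ≤ d by omega)
  obtain ⟨C, hC, hle⟩ := exists_sum_card_shell_mul_sq_le hd
  refine ⟨C * 3 ^ d / c ^ 2, by positivity, fun lam hlam h => ?_⟩
  have hNl := hN lam hlam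
  have hR := two_mul_sqrt_add_one_le lam
  rw [← sqrt_succ_pow_two_mul] at hNl
  have hK := (sum_fiberCard_sq_le d lam).trans (hle lam)
  set S := √((lam : ℝ) + 1)
  have hS : 0 < S := by positivity
  have hs : 0 ≤ ∑ u ∈ cube d lam.sqrt, h u ^ 2 := Finset.sum_nonneg fun u _ => sq_nonneg _
  calc (∑ u ∈ cube d lam.sqrt, (fiberCard lam u : ℝ) * h u) ^ 2
      ≤ (∑ u ∈ cube d lam.sqrt, (fiberCard lam u : ℝ) ^ 2) * ∑ u ∈ cube d lam.sqrt, h u ^ 2 :=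
        Finset.sum_mul_sq_le_sq_mul_sq _ _ _
    _ ≤ C * S ^ (3 * d - 4) * ∑ u ∈ cube d lam.sqrt, h u ^ 2 := by gcongr
    _ = C * 3 ^ d / c ^ 2 * (c * S ^ (2 * (d - 1))) ^ 2 *
          ((∑ u ∈ cube d lam.sqrt, h u ^ 2) / (3 * S) ^ d) := by
        rw [mul_pow c, ← pow_mul, show 2 * (d - 1) * 2 = (3 * d - 4) + d by omega, pow_add, mul_pow]
        field_simp
    _ ≤ _ := by gcongr

theorem exists_sum_fiberCard_mul_pow_le {d : ℕ} (hd : 3 ≤ d) {p : ℝ}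
    (hp : (d : ℝ) / ((d : ℝ) - 2) < p) :
    ∃ s : ℕ, 0 < s ∧ s < p ∧ ∃ C : ℝ, 0 < C ∧ ∀ lam : ℕ,
      0 < Ncount d lam → ∀ h : V d → ℝ, 0 ≤ h →
        (∑ u ∈ cube d lam.sqrt, (fiberCard lam u : ℝ) * h u) ^ s ≤
          C * (Ncount d lam : ℝ) ^ s *
            ((∑ u ∈ cube d lam.sqrt, h u ^ s) / (2 * lam.sqrt + 1) ^ d) := by
  by_cases h5 : 5 ≤ d
  · obtain ⟨C, hC, hle⟩ := exists_sum_fiberCard_mul_le h5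
    refine ⟨1, one_pos, ?_, C, hC, fun lam hlam h hh => by simpa using hle lam hlam h hh⟩
    refine lt_trans ?_ hp
    have : (5 : ℝ) ≤ d := by exact_mod_cast h5
    rw [Nat.cast_one, one_lt_div] <;> linarith
  · have h34 : d = 3 ∨ d = 4 := by omega
    obtain ⟨C, hC, hle⟩ := exists_sum_fiberCard_mul_sq_le h34
    refine ⟨2, two_pos, lt_of_le_of_lt ?_ hp, C, hC, fun lam hlam h _ => hle lam hlam h⟩
    rcases h34 with rfl | rfl <;> norm_num

theorem norm_avg_sq_le (d lam : ℕ) (f g : V d → ℂ) (x : V d) :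
    ‖avg d lam f g x‖ ^ 2 ≤ ((Ncount d lam : ℝ)⁻¹) ^ 2 *
      ((∑ u ∈ cube d lam.sqrt, (fiberCard lam u : ℝ) * ‖f (x - u)‖ ^ 2) *
        ∑ u ∈ cube d lam.sqrt, (fiberCard lam u : ℝ) * ‖g (x - u)‖ ^ 2) := by
  have h1 : avg d lam f g x = (Ncount d lam : ℂ)⁻¹ *
      ∑ uv ∈ (sph_finite d lam).toFinset, f (x - uv.1) * g (x - uv.2) := by
    rw [avg]
    congr 1
    rw [tsum_subtype (sph d lam) fun uv => f (x - uv.1) * g (x - uv.2),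
      tsum_eq_sum (s := (sph_finite d lam).toFinset)]
    · refine Finset.sum_congr rfl fun uv huv => ?_
      rw [Set.indicator_of_mem ((sph_finite d lam).mem_toFinset.1 huv)]
    · intro uv huv
      rw [Set.indicator_of_notMem fun h => huv ((sph_finite d lam).mem_toFinset.2 h)]
  rw [h1, norm_mul, mul_pow, norm_inv, Complex.norm_natCast]
  refine mul_le_mul_of_nonneg_left ?_ (by positivity)
  rw [← sum_sph_fst (lam := lam) fun u => ‖f (x - u)‖ ^ 2,
    ← sum_sph_fst (lam := lam) fun u => ‖g (x - u)‖ ^ 2,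
    ← sum_sph_snd (lam := lam) fun u => ‖g (x - u)‖ ^ 2]
  have h2 := Finset.sum_mul_sq_le_sq_mul_sq (sph_finite d lam).toFinset
    (fun uv => ‖f (x - uv.1)‖) fun uv => ‖g (x - uv.2)‖
  refine le_trans (pow_le_pow_left₀ (norm_nonneg _) ?_ 2) h2
  exact (norm_sum_le _ _).trans (le_of_eq (Finset.sum_congr rfl fun uv _ => norm_mul _ _))

/-- The average of `φ` over the cube of side length `2 R + 1` centred at `x`. -/
def cubeAvg {d : ℕ} (R : ℕ) (φ : V d → ℝ≥0∞) (x : V d) : ℝ≥0∞ :=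
  (∑ u ∈ cube d R, φ (x - u)) / ((2 * R + 1 : ℕ) : ℝ≥0∞) ^ d

theorem ofReal_cube_sum_div {d R : ℕ} (φ : V d → ℝ) (hφ : 0 ≤ φ) (x : V d) :
    ENNReal.ofReal ((∑ u ∈ cube d R, φ (x - u)) / (2 * R + 1) ^ d) =
      cubeAvg R (fun y => ENNReal.ofReal (φ y)) x := by
  rw [ENNReal.ofReal_div_of_pos (by positivity), ENNReal.ofReal_sum_of_nonneg fun u _ => hφ _,
    cubeAvg, ENNReal.ofReal_pow (by positivity)]
  congr 2
  rw [← ENNReal.ofReal_natCast]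
  push_cast
  rfl

theorem exists_enorm_avg_pow_le {d : ℕ} (hd : 3 ≤ d) {p : ℝ}
    (hp : (d : ℝ) / ((d : ℝ) - 2) < p) :
    ∃ s : ℕ, 0 < s ∧ s < p ∧ ∃ C : ℝ, 0 < C ∧ ∀ lam : ℕ, 0 < Ncount d lam →
      ∀ (f g : V d → ℂ) (x : V d), ‖avg d lam f g x‖ₑ ^ (2 * s) ≤ ENNReal.ofReal C *
        (cubeAvg lam.sqrt (fun y => ‖f y‖ₑ ^ (2 * s)) x *
          cubeAvg lam.sqrt (fun y => ‖g y‖ₑ ^ (2 * s)) x) := by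
  obtain ⟨s, hs, hsp, C, hC, hle⟩ := exists_sum_fiberCard_mul_pow_le hd hp
  refine ⟨s, hs, hsp, C ^ 2, by positivity, fun lam hlam f g x => ?_⟩
  have hN : (0 : ℝ) < Ncount d lam := by exact_mod_cast hlam
  have key : ‖avg d lam f g x‖ ^ (2 * s) ≤ C ^ 2 *
      (((∑ u ∈ cube d lam.sqrt, ‖f (x - u)‖ ^ (2 * s)) / (2 * lam.sqrt + 1) ^ d) *
        ((∑ u ∈ cube d lam.sqrt, ‖g (x - u)‖ ^ (2 * s)) / (2 * lam.sqrt + 1) ^ d)) := by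
    have hf := hle lam hlam (fun u => ‖f (x - u)‖ ^ 2) fun u => by positivity
    have hg := hle lam hlam (fun u => ‖g (x - u)‖ ^ 2) fun u => by positivity
    simp only [← pow_mul] at hf hg
    calc ‖avg d lam f g x‖ ^ (2 * s) = (‖avg d lam f g x‖ ^ 2) ^ s := by rw [pow_mul]
      _ ≤ _ := pow_le_pow_left₀ (by positivity) (norm_avg_sq_le d lam f g x) s
      _ = ((Ncount d lam : ℝ)⁻¹ ^ 2) ^ s *
          ((∑ u ∈ cube d lam.sqrt, (fiberCard lam u : ℝ) * ‖f (x - u)‖ ^ 2) ^ s *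
          (∑ u ∈ cube d lam.sqrt, (fiberCard lam u : ℝ) * ‖g (x - u)‖ ^ 2) ^ s) := by
        rw [mul_pow, mul_pow]
      _ ≤ _ := mul_le_mul_of_nonneg_left (mul_le_mul hf hg (by positivity) (by positivity))
          (by positivity)
      _ = _ := by
        rw [inv_pow, inv_pow, ← pow_mul, mul_comm 2 s, pow_mul]
        field_simp
  have := ENNReal.ofReal_le_ofReal key
  rw [ENNReal.ofReal_mul (by positivity), ENNReal.ofReal_mul (by positivity),
    ofReal_cube_sum_div (fun y => ‖f y‖ ^ (2 * s)) (fun y => by positivity),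
    ofReal_cube_sum_div (fun y => ‖g y‖ ^ (2 * s)) (fun y => by positivity)] at this
  simpa only [ENNReal.ofReal_pow (norm_nonneg _), ofReal_norm] using this

/-- The centred discrete Hardy–Littlewood maximal function over cubes. -/
def cubeMax {d : ℕ} (φ : V d → ℝ≥0∞) (x : V d) : ℝ≥0∞ :=
  ⨆ R : ℕ, cubeAvg R φ x

theorem cubeAvg_mul_card {d : ℕ} (R : ℕ) (φ : V d → ℝ≥0∞) (x : V d) :
    cubeAvg R φ x * ((2 * R + 1 : ℕ) : ℝ≥0∞) ^ d = ∑ u ∈ cube d R, φ (x - u) :=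
  ENNReal.div_mul_cancel (pow_ne_zero _ (by simp)) (by finiteness)

theorem mem_closedBall_iff_sub_mem_cube {d R : ℕ} {x y : V d} :
    y ∈ Metric.closedBall x (R : ℝ) ↔ x - y ∈ cube d R := by
  rw [Metric.mem_closedBall, dist_pi_le_iff (Nat.cast_nonneg _), mem_cube]
  refine forall_congr' fun i => ?_
  rw [Int.dist_eq, abs_le, Pi.sub_apply]
  norm_cast
  omega

theorem mul_card_le_of_lt_cubeMax {d : ℕ} (φ : V d → ℝ≥0∞) {t : ℝ≥0∞} (A : Finset (V d))
    (hA : ∀ x ∈ A, t < cubeMax φ x) : t * A.card ≤ 4 ^ d * ∑' x, φ x := by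
  classical
  have hR : ∀ x, ∃ R : ℕ, x ∈ A → t < cubeAvg R φ x := by
    intro x
    by_cases hx : x ∈ A
    · obtain ⟨R, hR⟩ := lt_iSup_iff.1 (hA x hx)
      exact ⟨R, fun _ => hR⟩
    · exact ⟨0, fun h => absurd h hx⟩
  choose R hR using hR
  obtain ⟨u, huA, hdisj, hcov⟩ := Vitali.exists_disjoint_subfamily_covering_enlargement_closedBall
    (A : Set (V d)) id (fun x => (R x : ℝ)) (∑ x ∈ A, (R x : ℝ))
    (fun a ha => Finset.single_le_sum (f := fun x => (R x : ℝ)) (fun _ _ => Nat.cast_nonneg _) ha)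
    4 (by norm_num)
  obtain ⟨U, rfl⟩ : ∃ U : Finset (V d), (U : Set (V d)) = u :=
    ⟨(A.finite_toSet.subset huA).toFinset, by simp⟩
  have hcard : A.card ≤ ∑ b ∈ U, (2 * (4 * R b) + 1) ^ d := by
    have hsub : A ⊆ U.biUnion fun b => (cube d (4 * R b)).image fun v => b - v := by
      intro a ha
      obtain ⟨b, hb, hab⟩ := hcov a ha
      have h1 : a ∈ Metric.closedBall b ((4 * R b : ℕ) : ℝ) := by
        push_cast
        exact hab (Metric.mem_closedBall_self (Nat.cast_nonneg _))
      rw [mem_closedBall_iff_sub_mem_cube] at h1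
      exact Finset.mem_biUnion.2 ⟨b, hb, Finset.mem_image.2 ⟨b - a, h1, sub_sub_cancel _ _⟩⟩
    refine (Finset.card_le_card hsub).trans (Finset.card_biUnion_le.trans ?_)
    refine Finset.sum_le_sum fun b _ => Finset.card_image_le.trans (card_cube _ _).le
  have hcard' : (A.card : ℝ≥0∞) ≤ 4 ^ d * ∑ b ∈ U, ((2 * R b + 1 : ℕ) : ℝ≥0∞) ^ d := by
    have : A.card ≤ 4 ^ d * ∑ b ∈ U, (2 * R b + 1) ^ d := by
      refine hcard.trans ?_
      rw [Finset.mul_sum]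
      refine Finset.sum_le_sum fun b _ => ?_
      rw [← mul_pow]
      exact Nat.pow_le_pow_left (by omega) d
    exact_mod_cast this
  have hball : ∀ b, ∑ v ∈ cube d (R b), φ (b - v) =
      ∑ y ∈ (cube d (R b)).image fun v => b - v, φ y := fun b => by
    rw [Finset.sum_image fun _ _ _ _ h => sub_right_injective h]
  calc t * A.card ≤ t * (4 ^ d * ∑ b ∈ U, ((2 * R b + 1 : ℕ) : ℝ≥0∞) ^ d) := by gcongr
    _ = 4 ^ d * ∑ b ∈ U, t * ((2 * R b + 1 : ℕ) : ℝ≥0∞) ^ d := by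
      rw [← Finset.mul_sum]; ring
    _ ≤ 4 ^ d * ∑ b ∈ U, ∑ v ∈ cube d (R b), φ (b - v) := by
      gcongr with b hb
      rw [← cubeAvg_mul_card]
      gcongr
      exact (hR b (huA hb)).le
    _ = 4 ^ d * ∑ y ∈ U.biUnion fun b => (cube d (R b)).image fun v => b - v, φ y := by
      rw [Finset.sum_biUnion, Finset.sum_congr rfl fun b _ => hball b]
      intro a ha b hb hab
      have h := hdisj ha hb hab
      rw [Function.onFun, Finset.disjoint_left]
      intro y hya hyb
      obtain ⟨v, hv, rfl⟩ := Finset.mem_image.1 hya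
      obtain ⟨w, hw, hwv⟩ := Finset.mem_image.1 hyb
      refine Set.disjoint_left.1 h (mem_closedBall_iff_sub_mem_cube.2 (?_ : a - (a - v) ∈ _))
        (mem_closedBall_iff_sub_mem_cube.2 (?_ : b - (a - v) ∈ _))
      · rwa [sub_sub_cancel]
      · rwa [← hwv, sub_sub_cancel]
    _ ≤ 4 ^ d * ∑' x, φ x := by
      gcongr
      exact ENNReal.sum_le_tsum _

open Classical in
theorem mul_tsum_lt_cubeMax_le {d : ℕ} (φ : V d → ℝ≥0∞) (t : ℝ≥0∞) :
    t * ∑' x, (if t < cubeMax φ x then 1 else 0) ≤ 4 ^ d * ∑' x, φ x := by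
  rw [ENNReal.tsum_eq_iSup_sum, ENNReal.mul_iSup]
  refine iSup_le fun A => ?_
  rw [Finset.sum_boole]
  exact mul_card_le_of_lt_cubeMax φ _ fun x hx => (Finset.mem_filter.1 hx).2

open Classical in
theorem cubeMax_le_add {d : ℕ} (φ : V d → ℝ≥0∞) (t : ℝ≥0∞) (x : V d) :
    cubeMax φ x ≤ cubeMax (fun y => if t < φ y then φ y else 0) x + t := by
  refine iSup_le fun R => ?_
  refine le_trans ?_ (add_le_add_left (le_iSup (fun R => cubeAvg R _ x) R) t)
  rw [cubeAvg, ENNReal.div_le_iff (pow_ne_zero _ (by simp)) (by finiteness), add_mul,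
    cubeAvg_mul_card]
  have h : t * ((2 * R + 1 : ℕ) : ℝ≥0∞) ^ d = ∑ u ∈ cube d R, t := by
    rw [Finset.sum_const, card_cube, nsmul_eq_mul, mul_comm]
    push_cast
    rfl
  rw [h, ← Finset.sum_add_distrib]
  refine Finset.sum_le_sum fun u _ => ?_
  split_ifs with hu
  · exact le_self_add
  · rw [zero_add]
    exact not_lt.1 hu

open Classical in
theorem mul_tsum_two_mul_lt_cubeMax_le {d : ℕ} (φ : V d → ℝ≥0∞) (t : ℝ≥0∞) :
    t * ∑' x, (if 2 * t < cubeMax φ x then 1 else 0) ≤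
      4 ^ d * ∑' x, if t < φ x then φ x else 0 := by
  refine le_trans ?_ (mul_tsum_lt_cubeMax_le (fun y => if t < φ y then φ y else 0) t)
  gcongr with x
  by_cases h : 2 * t < cubeMax φ x
  · have h1 : t < cubeMax (fun y => if t < φ y then φ y else 0) x := by
      have h2 := h.trans_le (cubeMax_le_add φ t x)
      rw [two_mul] at h2
      exact lt_of_add_lt_add_right h2
    rw [if_pos h, if_pos h1]
  · rw [if_neg h]
    exact zero_le

open MeasureTheory Set in
theorem lintegral_Ioo_rpow {r b : ℝ} (hr : 0 < r) (hb : 0 ≤ b) :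
    ∫⁻ t in Ioo 0 b, ENNReal.ofReal (t ^ (r - 1)) = ENNReal.ofReal (b ^ r / r) := by
  have h1 : IntervalIntegrable (fun t : ℝ => t ^ (r - 1)) volume 0 b :=
    intervalIntegral.intervalIntegrable_rpow' (by linarith)
  rw [intervalIntegrable_iff_integrableOn_Ioo_of_le hb] at h1
  rw [← ofReal_integral_eq_lintegral_ofReal h1, ← integral_Ioc_eq_integral_Ioo,
    ← intervalIntegral.integral_of_le hb, integral_rpow (Or.inl (by linarith)), sub_add_cancel,
    Real.zero_rpow hr.ne', sub_zero]
  exact (ae_restrict_iff' measurableSet_Ioo).2 (ae_of_all _ fun t ht => Real.rpow_nonneg ht.1.le _)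

open MeasureTheory Set in
theorem lintegral_ite_lt_rpow {r : ℝ} (hr : 0 < r) (a : ℝ≥0∞) :
    ∫⁻ t in Ioi (0 : ℝ), (if ENNReal.ofReal t < a then ENNReal.ofReal (t ^ (r - 1)) else 0) =
      a ^ r / ENNReal.ofReal r := by
  have hfin : ∀ b : ℝ≥0, ∫⁻ t in Ioi (0 : ℝ),
      (if ENNReal.ofReal t < b then ENNReal.ofReal (t ^ (r - 1)) else 0) =
        (b : ℝ≥0∞) ^ r / ENNReal.ofReal r := by
    intro b
    have h1 : ∀ t ∈ Ioi (0 : ℝ), (if ENNReal.ofReal t < b then ENNReal.ofReal (t ^ (r - 1)) else 0)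
        = (Iio (b : ℝ)).indicator (fun t => ENNReal.ofReal (t ^ (r - 1))) t := by
      intro t ht
      rw [indicator_apply]
      congr 1
      rw [← ENNReal.ofReal_coe_nnreal, ENNReal.ofReal_lt_ofReal_iff_of_nonneg (le_of_lt ht)]
      rfl
    rw [setLIntegral_congr_fun measurableSet_Ioi h1, setLIntegral_indicator measurableSet_Iio,
      inter_comm, Ioi_inter_Iio, lintegral_Ioo_rpow hr b.coe_nonneg, ENNReal.ofReal_div_of_pos hr,
      ← ENNReal.ofReal_coe_nnreal, ENNReal.ofReal_rpow_of_nonneg b.coe_nonneg hr.le]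
  induction a with
  | coe b => exact hfin b
  | top =>
    rw [ENNReal.top_rpow_of_pos hr, ENNReal.top_div_of_ne_top ENNReal.ofReal_ne_top]
    refine ENNReal.eq_top_of_forall_nnreal_le fun c => ?_
    obtain ⟨b, hb⟩ : ∃ b : ℝ≥0, (b : ℝ≥0∞) ^ r / ENNReal.ofReal r = c := by
      refine ⟨(c * r.toNNReal) ^ (1 / r), ?_⟩
      rw [← ENNReal.coe_rpow_of_nonneg _ hr.le, ← NNReal.rpow_mul, one_div,
        inv_mul_cancel₀ hr.ne', NNReal.rpow_one, ENNReal.coe_mul]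
      exact ENNReal.mul_div_cancel_right (by simpa using hr) ENNReal.coe_ne_top
    rw [← hb, ← hfin b]
    refine lintegral_mono fun t => ?_
    dsimp only
    split_ifs with h1 h2
    · exact le_rfl
    · exact absurd ENNReal.ofReal_lt_top h2
    · exact zero_le
    · exact le_rfl

open MeasureTheory Set in
theorem measurable_ite_ofReal_lt {f : ℝ → ℝ≥0∞} (hf : Measurable f) (a : ℝ≥0∞) :
    Measurable fun t : ℝ => if ENNReal.ofReal t < a then f t else 0 :=
  Measurable.ite (measurableSet_lt ENNReal.measurable_ofReal measurable_const) hf measurable_const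

open MeasureTheory Set Classical in
theorem tsum_cubeMax_rpow_le {d : ℕ} {q : ℝ} (hq : 1 < q) (φ : V d → ℝ≥0∞) :
    ∑' x, cubeMax φ x ^ q ≤
      ENNReal.ofReal q * (2 * 4 ^ d) * (2 ^ (q - 1) / ENNReal.ofReal (q - 1)) * ∑' x, φ x ^ q := by
  have hq0 : 0 < q := by linarith
  have hq1 : 0 < q - 1 := by linarith
  have e1 : ∀ x, cubeMax φ x ^ q = ENNReal.ofReal q * ∫⁻ t in Ioi (0 : ℝ),
      (if ENNReal.ofReal t < cubeMax φ x then ENNReal.ofReal (t ^ (q - 1)) else 0) := by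
    intro x
    rw [lintegral_ite_lt_rpow hq0, ENNReal.mul_div_cancel (by simpa using hq0) (by finiteness)]
  have e2 : ∀ x, φ x * (2 * φ x) ^ (q - 1) = 2 ^ (q - 1) * φ x ^ q := by
    intro x
    rw [ENNReal.mul_rpow_of_nonneg _ _ hq1.le, mul_left_comm]
    congr 1
    conv_lhs => rw [← ENNReal.rpow_one (φ x), ← ENNReal.rpow_mul, one_mul]
    rw [← ENNReal.rpow_add_of_nonneg _ _ zero_le_one hq1.le, add_sub_cancel]
  have key : ∀ t ∈ Ioi (0 : ℝ),
      ∑' x, (if ENNReal.ofReal t < cubeMax φ x then ENNReal.ofReal (t ^ (q - 1)) else 0) ≤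
        2 * 4 ^ d * ∑' x, φ x *
          if ENNReal.ofReal t < 2 * φ x then ENNReal.ofReal (t ^ (q - 1 - 1)) else 0 := by
    intro t ht
    rw [mem_Ioi] at ht
    have h1 := mul_tsum_two_mul_lt_cubeMax_le φ (ENNReal.ofReal (t / 2))
    have h2 : 2 * ENNReal.ofReal (t / 2) = ENNReal.ofReal t := by
      rw [← ENNReal.ofReal_ofNat, ← ENNReal.ofReal_mul (by norm_num)]
      congr 1
      ring
    have h3 : ∀ x, ENNReal.ofReal (t / 2) < φ x ↔ ENNReal.ofReal t < 2 * φ x := by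
      intro x
      rw [← h2, ENNReal.mul_lt_mul_iff_right (by simp) (by simp)]
    have h4 : ENNReal.ofReal (t ^ (q - 1)) =
        ENNReal.ofReal (t ^ (q - 1 - 1)) * (2 * ENNReal.ofReal (t / 2)) := by
      rw [h2, ← ENNReal.ofReal_mul (by positivity)]
      congr 1
      rw [← Real.rpow_add_one ht.ne', sub_add_cancel]
    calc _ = ENNReal.ofReal (t ^ (q - 1)) *
          ∑' x, (if ENNReal.ofReal t < cubeMax φ x then 1 else 0) := by
          rw [← ENNReal.tsum_mul_left]
          simp only [mul_ite, mul_one, mul_zero]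
      _ = ENNReal.ofReal (t ^ (q - 1 - 1)) * 2 * (ENNReal.ofReal (t / 2) *
          ∑' x, (if 2 * ENNReal.ofReal (t / 2) < cubeMax φ x then 1 else 0)) := by
          rw [h4, ← h2]; ring
      _ ≤ ENNReal.ofReal (t ^ (q - 1 - 1)) * 2 *
          (4 ^ d * ∑' x, if ENNReal.ofReal (t / 2) < φ x then φ x else 0) := by gcongr
      _ = 2 * 4 ^ d * (ENNReal.ofReal (t ^ (q - 1 - 1)) *
          ∑' x, if ENNReal.ofReal (t / 2) < φ x then φ x else 0) := by ring
      _ = _ := by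
          rw [← ENNReal.tsum_mul_left]
          simp only [h3, mul_ite, ite_mul, zero_mul, mul_zero, mul_comm (φ _)]
  calc ∑' x, cubeMax φ x ^ q = ENNReal.ofReal q * ∫⁻ t in Ioi (0 : ℝ), ∑' x,
        (if ENNReal.ofReal t < cubeMax φ x then ENNReal.ofReal (t ^ (q - 1)) else 0) := by
        simp only [e1]
        rw [ENNReal.tsum_mul_left, lintegral_tsum fun x =>
          (measurable_ite_ofReal_lt (by fun_prop) _).aemeasurable]
    _ ≤ ENNReal.ofReal q * ∫⁻ t in Ioi (0 : ℝ), 2 * 4 ^ d * ∑' x, φ x *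
          if ENNReal.ofReal t < 2 * φ x then ENNReal.ofReal (t ^ (q - 1 - 1)) else 0 := by
        gcongr 1
        exact setLIntegral_mono' measurableSet_Ioi key
    _ = ENNReal.ofReal q * (2 * 4 ^ d * ∑' x, φ x *
          ((2 * φ x) ^ (q - 1) / ENNReal.ofReal (q - 1))) := by
        have hm : ∀ x : V d, Measurable fun t : ℝ =>
            if ENNReal.ofReal t < 2 * φ x then ENNReal.ofReal (t ^ (q - 1 - 1)) else 0 :=
          fun x => measurable_ite_ofReal_lt (by fun_prop) _
        rw [lintegral_const_mul' _ _ (by finiteness), lintegral_tsum fun x =>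
          ((hm x).const_mul _).aemeasurable]
        congr 3
        ext x
        rw [lintegral_const_mul _ (hm x), lintegral_ite_lt_rpow hq1]
    _ = _ := by
        simp only [← mul_div_assoc, e2]
        simp only [div_eq_mul_inv]
        rw [ENNReal.tsum_mul_right, ENNReal.tsum_mul_left]
        ring

theorem exists_tsum_cubeMax_rpow_le (d : ℕ) {q : ℝ} (hq : 1 < q) :
    ∃ A : ℝ≥0, ∀ φ : V d → ℝ≥0∞, ∑' x, cubeMax φ x ^ q ≤ A * ∑' x, φ x ^ q := by
  have h : ENNReal.ofReal q * (2 * 4 ^ d) * (2 ^ (q - 1) / ENNReal.ofReal (q - 1)) ≠ ∞ :=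
    ENNReal.mul_ne_top (by finiteness) (ENNReal.div_ne_top (by finiteness) (by simpa using hq))
  obtain ⟨A, hA⟩ := WithTop.ne_top_iff_exists.1 h
  exact ⟨A, fun φ => by
    have := tsum_cubeMax_rpow_le hq φ
    rwa [← hA] at this⟩

theorem maxOp_pow_le_cubeMax {d : ℕ} (hd : 3 ≤ d) {p : ℝ}
    (hp : (d : ℝ) / ((d : ℝ) - 2) < p) :
    ∃ s : ℕ, 0 < s ∧ s < p ∧ ∃ C : ℝ≥0, ∀ (f g : V d → ℂ) (x : V d),
      maxOp d f g x ^ (2 * s) ≤ C *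
        (cubeMax (fun y => ‖f y‖ₑ ^ (2 * s)) x * cubeMax (fun y => ‖g y‖ₑ ^ (2 * s)) x) := by
  obtain ⟨s, hs, hsp, C, -, hle⟩ := exists_enorm_avg_pow_le hd hp
  refine ⟨s, hs, hsp, C.toNNReal, fun f g x => ?_⟩
  have h2s : (0 : ℝ) < (2 * s : ℕ) := by exact_mod_cast (by omega : 0 < 2 * s)
  rw [← ENNReal.rpow_natCast, ← ENNReal.le_rpow_inv_iff h2s, maxOp]
  refine iSup₂_le fun lam hlam => ?_
  rw [ENNReal.le_rpow_inv_iff h2s, ENNReal.rpow_natCast]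
  refine (hle lam hlam f g x).trans ?_
  exact mul_le_mul_right (mul_le_mul' (le_iSup (fun R => cubeAvg R _ x) _)
    (le_iSup (fun R => cubeAvg R _ x) _)) _

theorem tsum_mul_le_sqrt_mul_sqrt {ι : Type*} (f g : ι → ℝ≥0∞) :
    ∑' i, f i * g i ≤ (∑' i, f i ^ (2 : ℝ)) ^ (1 / 2 : ℝ) * (∑' i, g i ^ (2 : ℝ)) ^ (1 / 2 : ℝ) := by
  rw [ENNReal.tsum_eq_iSup_sum]
  refine iSup_le fun s => (ENNReal.inner_le_Lp_mul_Lq s f g Real.HolderConjugate.two_two).trans ?_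
  gcongr <;> exact ENNReal.sum_le_tsum s

/-- For `d ≥ 3` and `p > d/(d-2)`, the bilinear discrete spherical maximal
operator is bounded from `l^{2p}(ℤ^d) × l^{2p}(ℤ^d)` to `l^p(ℤ^d)`. -/
theorem bilinear_discrete_spherical_l2p_l2p_lp
    (d : ℕ) (hd : 3 ≤ d) (p : ℝ) (hp : (d : ℝ) / ((d : ℝ) - 2) < p) :
    ∃ C : ℝ≥0, ∀ f g : V d → ℂ,
      lpNormE d p (maxOp d f g) ≤ C * lpNorm d (2 * p) f * lpNorm d (2 * p) g := by
  obtain ⟨s, hs, hsp, C, hle⟩ := maxOp_pow_le_cubeMax hd hp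
  have hs0 : (0 : ℝ) < s := by exact_mod_cast hs
  have hp0 : 0 < p := hs0.trans hsp
  set q : ℝ := p / s with hq
  have hq1 : 1 < q := (one_lt_div hs0).2 hsp
  have hq0 : 0 < q := by linarith
  obtain ⟨A, hA⟩ := exists_tsum_cubeMax_rpow_le d hq1
  have hCtop : ((C : ℝ≥0∞) ^ (q / 2) * A) ^ (1 / p) ≠ ∞ :=
    ENNReal.rpow_ne_top_of_nonneg (by positivity)
      (ENNReal.mul_ne_top (ENNReal.rpow_ne_top_of_nonneg (by positivity) ENNReal.coe_ne_top) ENNReal.coe_ne_top)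
  refine ⟨(((C : ℝ≥0∞) ^ (q / 2) * A) ^ (1 / p)).toNNReal, fun f g => ?_⟩
  rw [ENNReal.coe_toNNReal hCtop]
  have hmax : ∀ f : V d → ℂ, ∑' x, cubeMax (fun y => ‖f y‖ₑ ^ (2 * s)) x ^ q ≤
      A * ∑' x, ‖f x‖ₑ ^ (2 * p) := by
    intro f
    refine (hA _).trans (le_of_eq ?_)
    congr 2
    ext x
    rw [← ENNReal.rpow_natCast, ← ENNReal.rpow_mul, hq]
    congr 1
    push_cast
    field_simp
  have hpt : ∀ x, maxOp d f g x ^ p ≤ (C : ℝ≥0∞) ^ (q / 2) *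
      (cubeMax (fun y => ‖f y‖ₑ ^ (2 * s)) x ^ (q / 2) *
        cubeMax (fun y => ‖g y‖ₑ ^ (2 * s)) x ^ (q / 2)) := by
    intro x
    rw [← ENNReal.mul_rpow_of_nonneg _ _ (by positivity),
      ← ENNReal.mul_rpow_of_nonneg _ _ (by positivity)]
    refine le_trans (le_of_eq ?_) (ENNReal.rpow_le_rpow (hle f g x) (by positivity : 0 ≤ q / 2))
    rw [← ENNReal.rpow_natCast, ← ENNReal.rpow_mul, hq]
    congr 1
    push_cast
    field_simp
  have hhalf : ∀ a : ℝ≥0∞, (a ^ (q / 2)) ^ (2 : ℝ) = a ^ q := fun a => by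
    rw [← ENNReal.rpow_mul, div_mul_cancel₀ _ two_ne_zero]
  have hsum : ∑' x, maxOp d f g x ^ p ≤ (C : ℝ≥0∞) ^ (q / 2) * A *
      ((∑' x, ‖f x‖ₑ ^ (2 * p)) ^ (1 / 2 : ℝ) * (∑' x, ‖g x‖ₑ ^ (2 * p)) ^ (1 / 2 : ℝ)) := by
    refine (ENNReal.tsum_le_tsum hpt).trans ?_
    rw [ENNReal.tsum_mul_left, mul_assoc]
    refine mul_le_mul_right ((tsum_mul_le_sqrt_mul_sqrt _ _).trans ?_) _
    simp only [hhalf]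
    refine (mul_le_mul' (ENNReal.rpow_le_rpow (hmax f) (by norm_num))
      (ENNReal.rpow_le_rpow (hmax g) (by norm_num))).trans (le_of_eq ?_)
    rw [ENNReal.mul_rpow_of_nonneg _ _ (by norm_num), ENNReal.mul_rpow_of_nonneg _ _ (by norm_num),
      mul_mul_mul_comm, ← ENNReal.rpow_add_of_nonneg _ _ (by norm_num) (by norm_num), add_halves,
      ENNReal.rpow_one]
  rw [lpNormE, lpNorm, lpNorm]
  refine (ENNReal.rpow_le_rpow hsum (by positivity)).trans (le_of_eq ?_)
  rw [ENNReal.mul_rpow_of_nonneg ((C : ℝ≥0∞) ^ (q / 2) * A) _ (by positivity),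
    ENNReal.mul_rpow_of_nonneg (_ ^ (1 / 2 : ℝ)) _ (by positivity),
    ← ENNReal.rpow_mul, ← ENNReal.rpow_mul, ← mul_assoc, one_div_mul_one_div]
  rfl
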